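/- Let α ≥ -1, p > 2 and C ≥ 1. The following three statements are equivalent: (a) ‖f‖_{A^p_{(p/2)(α+2)−2}} ≤ C ‖f‖_{A²_α} for every f holomorphic on 𝔻 with ‖f‖_{A²_α} < ∞; (b) F_p(f) ≤ C^p for every f holomorphic on 𝔻 with ‖f‖_{A²_α} = 1; (c) there exists M > 0 such that G_p(f) ≤ C^p for every f holomorphic on 𝔻 with ‖f‖_{A²_α} = 1 and f^{(j)}(0) = 0 for all integers 0 ≤ j ≤ M. -/

import Mathlib

open MeasureTheory Set Filter
open scoped ENNReal NNReal Topology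

noncomputable section

/-- The open unit disk in `ℂ`. -/
def unitDisk : Set ℂ := Metric.ball 0 1

/-- `c_β(n) = Γ(n+β)/(Γ(β)·n!)`. -/
def ccoef (β : ℝ) (n : ℕ) : ℝ := Real.Gamma (n + β) / (Real.Gamma β * n.factorial)

/-- The `n`-th Taylor coefficient of `f` at the origin. -/
def taylorCoeff (f : ℂ → ℂ) (n : ℕ) : ℂ := iteratedDeriv n f 0 / n.factorial

/-- The square of the `A²_α` norm, `∑ |a_n|²/c_{α+2}(n)`, valued in `[0,∞]`. -/
def A2normSq (α : ℝ) (f : ℂ → ℂ) : ℝ≥0∞ :=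
  ∑' n : ℕ, ENNReal.ofReal (‖taylorCoeff f n‖ ^ 2 / ccoef (α + 2) n)

/-- The `A²_α` norm (Hardy `H²` norm when `α = -1`). -/
def A2norm (α : ℝ) (f : ℂ → ℂ) : ℝ≥0∞ := A2normSq α f ^ (1 / 2 : ℝ)

/-- The `p`-th power of the weighted Bergman norm `‖f‖_{A^p_β}`, valued in `[0,∞]`:
`(β+1) ∫_𝔻 (1-|z|²)^β |f z|^p dA(z)` with `dA` the normalized area measure. -/
def ApIntPow (p β : ℝ) (f : ℂ → ℂ) : ℝ≥0∞ :=
  ENNReal.ofReal (β + 1) *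
    (∫⁻ z in unitDisk, ENNReal.ofReal ((1 - ‖z‖ ^ 2) ^ β * ‖f z‖ ^ p)) / ENNReal.ofReal Real.pi

/-- The weighted Bergman norm `‖f‖_{A^p_β}`, valued in `[0,∞]`. -/
def ApNorm (p β : ℝ) (f : ℂ → ℂ) : ℝ≥0∞ := ApIntPow p β f ^ (1 / p)

/-- The inner integral `∫₀¹ s^{α+1}/(1-(1-|z|²)s) ds`, valued in `[0,∞]`. -/
def Hinner (α : ℝ) (z : ℂ) : ℝ≥0∞ :=
  ∫⁻ s in Set.Ioo (0 : ℝ) 1, ENNReal.ofReal (s ^ (α + 1) / (1 - (1 - ‖z‖ ^ 2) * s))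

/-- The quantity `F_p(f)`. -/
def Ffun (α p : ℝ) (f : ℂ → ℂ) : ℝ≥0∞ :=
  ENNReal.ofReal (‖f 0‖ ^ p) +
    ENNReal.ofReal (p / 2) *
      (∫⁻ z in unitDisk,
        ENNReal.ofReal (‖deriv f z‖ ^ 2 * ‖f z‖ ^ (p - 2) * (1 - ‖z‖ ^ 2) ^ (p * (α + 2) / 2)) *
          Hinner α z) / ENNReal.ofReal Real.pi

/-- The quantity `G_p(f)`. -/
def Gfun (α p : ℝ) (f : ℂ → ℂ) : ℝ≥0∞ :=
  ENNReal.ofReal (p / (2 * (α + 2))) *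
    (∫⁻ z in unitDisk,
      ENNReal.ofReal (‖deriv f z‖ ^ 2 * ‖f z‖ ^ (p - 2) * (1 - ‖z‖ ^ 2) ^ (p * (α + 2) / 2))) /
    ENNReal.ofReal Real.pi

section

open scoped ComplexConjugate

/-- `W` has Wirtinger derivatives `∂W = P` and `∂̄W = Q` on the unit disk, expressed along curves. -/
def HasWirtinger (W P Q : ℂ → ℂ) : Prop :=
  ∀ (γ : ℝ → ℂ) (v : ℂ) (t : ℝ), γ t ∈ unitDisk → HasDerivAt γ v t →
    HasDerivAt (fun s => W (γ s)) (P (γ t) * v + Q (γ t) * conj v) t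

lemma mem_unitDisk_iff {z : ℂ} : z ∈ unitDisk ↔ ‖z‖ < 1 := by simp [unitDisk]

lemma norm_real_mul_exp_I (s θ : ℝ) : ‖(s : ℂ) * Complex.exp (θ * Complex.I)‖ = |s| := by
  simp [Complex.norm_exp_ofReal_mul_I]

lemma real_mul_exp_I_mem_unitDisk {s : ℝ} (h : |s| < 1) (θ : ℝ) :
    (s : ℂ) * Complex.exp (θ * Complex.I) ∈ unitDisk := by
  rw [mem_unitDisk_iff, norm_real_mul_exp_I]; exact h

lemma conj_exp_I (θ : ℝ) :
    conj (Complex.exp (θ * Complex.I)) = Complex.exp (-(θ * Complex.I)) := by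
  rw [← Complex.exp_conj]; simp

lemma continuousOn_comp_polar {Q : ℂ → ℂ} (hQ : ContinuousOn Q unitDisk) :
    ContinuousOn (fun x : ℝ × ℝ => Q ((x.1 : ℂ) * Complex.exp (x.2 * Complex.I)))
      {x | |x.1| < 1} :=
  hQ.comp (by fun_prop) fun x hx => real_mul_exp_I_mem_unitDisk hx x.2

/-- Green's formula on disks centred at the origin, in integrated form. -/
lemma HasWirtinger.integral_circle {W P Q : ℂ → ℂ} (hW : HasWirtinger W P Q)
    (hP : ContinuousOn P unitDisk) (hQ : ContinuousOn Q unitDisk) {r : ℝ} (hr0 : 0 ≤ r)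
    (hr1 : r < 1) :
    ∫ θ in -Real.pi..Real.pi, W (r * Complex.exp (θ * Complex.I)) =
      2 * Real.pi * W 0 + ∫ s in (0 : ℝ)..r, 2 * ∫ θ in -Real.pi..Real.pi,
        Q (s * Complex.exp (θ * Complex.I)) * Complex.exp (-(θ * Complex.I)) := by
  have hcP := continuousOn_comp_polar hP
  have hcQ := continuousOn_comp_polar hQ
  have habs : ∀ s ∈ uIcc 0 r, |s| < 1 := by
    intro s hs
    rw [uIcc_of_le hr0] at hs
    rw [abs_of_nonneg hs.1]; linarith [hs.2]
  set D : ℝ → ℝ → ℂ := fun θ s =>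
    P (s * Complex.exp (θ * Complex.I)) * Complex.exp (θ * Complex.I) +
      Q (s * Complex.exp (θ * Complex.I)) * Complex.exp (-(θ * Complex.I)) with hD
  have hcA : ContinuousOn (fun x : ℝ × ℝ =>
      P (x.1 * Complex.exp (x.2 * Complex.I)) * Complex.exp (x.2 * Complex.I)) {x | |x.1| < 1} :=
    hcP.mul (by fun_prop)
  have hcB : ContinuousOn (fun x : ℝ × ℝ =>
      Q (x.1 * Complex.exp (x.2 * Complex.I)) * Complex.exp (-(x.2 * Complex.I)))
      {x | |x.1| < 1} :=
    hcQ.mul (by fun_prop)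
  have hradial : ∀ θ : ℝ, ∫ s in (0 : ℝ)..r, D θ s =
      W (r * Complex.exp (θ * Complex.I)) - W 0 := by
    intro θ
    have h1 : ∀ s ∈ uIcc 0 r, HasDerivAt (fun s : ℝ => W (s * Complex.exp (θ * Complex.I)))
        (D θ s) s := by
      intro s hs
      have := hW (fun s : ℝ => s * Complex.exp (θ * Complex.I)) (Complex.exp (θ * Complex.I)) s
        (real_mul_exp_I_mem_unitDisk (habs s hs) θ)
        (by simpa using (Complex.ofRealCLM.hasDerivAt (x := s)).mul_const
              (Complex.exp (θ * Complex.I)))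
      rwa [conj_exp_I] at this
    rw [intervalIntegral.integral_eq_sub_of_hasDerivAt h1]
    · simp
    · apply ContinuousOn.intervalIntegrable
      exact (hcA.add hcB).comp (f := fun s : ℝ => (s, θ)) (by fun_prop) habs
  have hangular : ∀ s ∈ uIcc 0 r, s ≠ 0 →
      ∫ θ in -Real.pi..Real.pi, P (s * Complex.exp (θ * Complex.I)) * Complex.exp (θ * Complex.I) =
      ∫ θ in -Real.pi..Real.pi,
        Q (s * Complex.exp (θ * Complex.I)) * Complex.exp (-(θ * Complex.I)) := by
    intro s hs hs0
    have hA : Continuous fun θ : ℝ =>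
        P (s * Complex.exp (θ * Complex.I)) * Complex.exp (θ * Complex.I) := by
      rw [← continuousOn_univ]
      exact hcA.comp (f := fun θ : ℝ => (s, θ)) (by fun_prop) (fun _ _ => habs s hs)
    have hB : Continuous fun θ : ℝ =>
        Q (s * Complex.exp (θ * Complex.I)) * Complex.exp (-(θ * Complex.I)) := by
      rw [← continuousOn_univ]
      exact hcB.comp (f := fun θ : ℝ => (s, θ)) (by fun_prop) (fun _ _ => habs s hs)
    have h1 : ∀ θ ∈ uIcc (-Real.pi) Real.pi,
        HasDerivAt (fun θ : ℝ => W (s * Complex.exp (θ * Complex.I)))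
        ((s * Complex.I) * (P (s * Complex.exp (θ * Complex.I)) * Complex.exp (θ * Complex.I) -
          Q (s * Complex.exp (θ * Complex.I)) * Complex.exp (-(θ * Complex.I)))) θ := by
      intro θ _
      have h2 : HasDerivAt (fun θ : ℝ => (s : ℂ) * Complex.exp (θ * Complex.I))
          (s * (Complex.exp (θ * Complex.I) * Complex.I)) θ := by
        have := (((Complex.ofRealCLM.hasDerivAt (x := θ)).mul_const Complex.I).cexp).const_mul (s : ℂ)
        simpa using this
      have := hW _ _ θ (real_mul_exp_I_mem_unitDisk (habs s hs) θ) h2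
      convert this using 1
      simp only [map_mul, conj_exp_I, Complex.conj_I, Complex.conj_ofReal]
      ring
    have h3 := intervalIntegral.integral_eq_sub_of_hasDerivAt h1
      (((hA.sub hB).const_mul _).intervalIntegrable _ _)
    rw [intervalIntegral.integral_const_mul,
      intervalIntegral.integral_sub (hA.intervalIntegrable _ _) (hB.intervalIntegrable _ _)] at h3
    have h4 : Complex.exp ((-Real.pi : ℝ) * Complex.I) = Complex.exp (Real.pi * Complex.I) := by
      rw [Complex.ofReal_neg, neg_mul, Complex.exp_neg, Complex.exp_pi_mul_I]; norm_num
    rw [h4, sub_self] at h3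
    have h5 : (s : ℂ) * Complex.I ≠ 0 := by simp [hs0]
    exact sub_eq_zero.1 ((mul_eq_zero.1 h3).resolve_left h5)
  have hint : IntegrableOn (Function.uncurry D) (uIoc (-Real.pi) Real.pi ×ˢ uIoc 0 r) := by
    have hc : ContinuousOn (Function.uncurry D) (uIcc (-Real.pi) Real.pi ×ˢ uIcc 0 r) := by
      refine (hcA.add hcB).comp (f := fun x : ℝ × ℝ => (x.2, x.1)) (by fun_prop) ?_
      rintro ⟨θ, s⟩ ⟨_, hs⟩
      exact habs s hs
    exact (hc.integrableOn_compact (isCompact_uIcc.prod isCompact_uIcc)).mono_set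
      (prod_mono uIoc_subset_uIcc uIoc_subset_uIcc)
  have hswap := intervalIntegral_intervalIntegral_swap hint
  simp_rw [hradial] at hswap
  have hWc : Continuous fun θ : ℝ => W (r * Complex.exp (θ * Complex.I)) := by
    rw [continuous_iff_continuousAt]
    intro θ
    have h2 : HasDerivAt (fun θ : ℝ => (r : ℂ) * Complex.exp (θ * Complex.I))
        (r * (Complex.exp (θ * Complex.I) * Complex.I)) θ := by
      have := (((Complex.ofRealCLM.hasDerivAt (x := θ)).mul_const Complex.I).cexp).const_mul (r : ℂ)
      simpa using this
    exact (hW _ _ θ (real_mul_exp_I_mem_unitDisk (habs r right_mem_uIcc) θ) h2).continuousAt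
  rw [intervalIntegral.integral_sub (hWc.intervalIntegrable _ _) (by simp)] at hswap
  have hin : ∫ s in (0 : ℝ)..r, ∫ θ in -Real.pi..Real.pi, D θ s =
      ∫ s in (0 : ℝ)..r, 2 * ∫ θ in -Real.pi..Real.pi,
        Q (s * Complex.exp (θ * Complex.I)) * Complex.exp (-(θ * Complex.I)) := by
    apply intervalIntegral.integral_congr_ae
    refine Eventually.of_forall fun s hs => ?_
    have hs0 : s ≠ 0 := by
      rw [uIoc_of_le hr0] at hs; exact hs.1.ne'
    have hs' := uIoc_subset_uIcc hs
    have hA : Continuous fun θ : ℝ =>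
        P (s * Complex.exp (θ * Complex.I)) * Complex.exp (θ * Complex.I) := by
      rw [← continuousOn_univ]
      exact hcA.comp (f := fun θ : ℝ => (s, θ)) (by fun_prop) (fun _ _ => habs s hs')
    have hB : Continuous fun θ : ℝ =>
        Q (s * Complex.exp (θ * Complex.I)) * Complex.exp (-(θ * Complex.I)) := by
      rw [← continuousOn_univ]
      exact hcB.comp (f := fun θ : ℝ => (s, θ)) (by fun_prop) (fun _ _ => habs s hs')
    simp only [hD]
    rw [intervalIntegral.integral_add (hA.intervalIntegrable _ _) (hB.intervalIntegrable _ _),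
      hangular s hs' hs0, two_mul]
  rw [hin] at hswap
  rw [← hswap, intervalIntegral.integral_const]
  simp only [Complex.real_smul]
  push_cast
  ring

lemma HasDerivAt.norm_rpow_complex {η : ℝ → ℂ} {v : ℂ} {t p : ℝ} (hp : 1 < p)
    (h : HasDerivAt η v t) :
    HasDerivAt (fun s => ‖η s‖ ^ p) (p * ‖η t‖ ^ (p - 2) * (conj (η t) * v).re) t := by
  have := (hasFDerivAt_norm_rpow (η t) hp).comp_hasDerivAt t h
  refine this.congr_deriv ?_
  simp [Complex.inner, mul_comm]

lemma hasDerivAt_norm_rpow_mul_conj {η : ℝ → ℂ} {v : ℂ} {t p : ℝ} (hp : 2 < p)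
    (h : HasDerivAt η v t) :
    HasDerivAt (fun s => ((‖η s‖ ^ (p - 2) : ℝ) : ℂ) * conj (η s))
      ((p - 2) / 2 * (((‖η t‖ ^ (p - 4) : ℝ) : ℂ) * conj (η t) ^ 2) * v +
        p / 2 * ((‖η t‖ ^ (p - 2) : ℝ) : ℂ) * conj v) t := by
  by_cases h0 : η t = 0
  · have hz : ((p - 2) / 2 * (((‖η t‖ ^ (p - 4) : ℝ) : ℂ) * conj (η t) ^ 2) * v +
        p / 2 * ((‖η t‖ ^ (p - 2) : ℝ) : ℂ) * conj v) = 0 := by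
      simp [h0, Real.zero_rpow (by linarith : p - 2 ≠ 0)]
    rw [hz, hasDerivAt_iff_isLittleO]
    have hO : (fun s => conj (η s)) =O[𝓝 t] fun s => s - t := by
      have := h.isBigO_sub
      simp only [h0, sub_zero] at this
      refine Asymptotics.IsBigO.trans (Asymptotics.IsBigO.of_bound 1 ?_) this
      exact Eventually.of_forall fun s => by simp
    have ho : (fun s => ((‖η s‖ ^ (p - 2) : ℝ) : ℂ)) =o[𝓝 t] fun _ => (1 : ℝ) := by
      rw [Asymptotics.isLittleO_one_iff]
      have hc : ContinuousAt (fun s => ((‖η s‖ ^ (p - 2) : ℝ) : ℂ)) t := by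
        apply Complex.continuous_ofReal.continuousAt.comp
        exact h.continuousAt.norm.rpow_const (Or.inr (by linarith))
      have := hc.tendsto
      simpa [h0, Real.zero_rpow (by linarith : p - 2 ≠ 0)] using this
    have := ho.mul_isBigO hO
    simpa [h0] using this
  · have hn : ‖η t‖ ≠ 0 := norm_ne_zero_iff.2 h0
    have hn' : 0 < ‖η t‖ := norm_pos_iff.2 h0
    have h1 : HasDerivAt (fun s => ‖η s‖ ^ 2) (2 * (conj (η t) * v).re) t := by
      have := h.norm_sq
      convert this using 2
      simp [Complex.inner, mul_comm]
    have h2 := h1.rpow_const (p := (p - 2) / 2) (Or.inl (by positivity))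
    have h3 : (fun s => (‖η s‖ ^ 2) ^ ((p - 2) / 2)) = fun s => ‖η s‖ ^ (p - 2) := by
      funext s
      rw [← Real.rpow_natCast, ← Real.rpow_mul (norm_nonneg _)]
      congr 1; push_cast; ring
    rw [h3] at h2
    have h4 : HasDerivAt (fun s => conj (η s)) (conj v) t :=
      (Complex.conjCLE.hasFDerivAt (x := η t)).comp_hasDerivAt t h
    have h5 := h2.ofReal_comp.mul h4
    refine h5.congr_deriv ?_
    have h6 : (‖η t‖ ^ 2) ^ ((p - 2) / 2 - 1) = ‖η t‖ ^ (p - 4) := by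
      rw [← Real.rpow_natCast, ← Real.rpow_mul (norm_nonneg _)]
      congr 1; push_cast; ring
    have h7 : ‖η t‖ ^ (p - 2) = ‖η t‖ ^ (p - 4) * ‖η t‖ ^ 2 := by
      rw [← Real.rpow_natCast, ← Real.rpow_add hn']
      congr 1; push_cast; ring
    have h8 : ((‖η t‖ ^ 2 : ℝ) : ℂ) = conj (η t) * η t := by
      rw [mul_comm, Complex.mul_conj, Complex.normSq_eq_norm_sq]
    have h9 : ((2 * (conj (η t) * v).re : ℝ) : ℂ) = conj (η t) * v + η t * conj v := by
      have := Complex.add_conj (conj (η t) * v)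
      simp only [map_mul, Complex.conj_conj] at this
      rw [this]
    rw [h6, h7, Complex.ofReal_mul (‖η t‖ ^ (p - 4)), h8]
    simp only [Complex.ofReal_mul (2 * (conj (η t) * v).re * _), 
      Complex.ofReal_mul (2 * (conj (η t) * v).re), h9]
    push_cast
    ring

lemma continuous_norm_rpow_mul_conj_sq {p : ℝ} (hp : 2 < p) :
    Continuous fun ζ : ℂ => ((‖ζ‖ ^ (p - 4) : ℝ) : ℂ) * conj ζ ^ 2 := by
  rw [continuous_iff_continuousAt]
  intro ζ
  by_cases h0 : ζ = 0
  · subst h0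
    have hlim : Tendsto (fun ζ : ℂ => ‖ζ‖ ^ (p - 2)) (𝓝 0) (𝓝 0) := by
      have : ContinuousAt (fun ζ : ℂ => ‖ζ‖ ^ (p - 2)) 0 :=
        continuousAt_id.norm.rpow_const (Or.inr (by linarith))
      simpa [Real.zero_rpow (by linarith : p - 2 ≠ 0)] using this.tendsto
    have hz : ((‖(0 : ℂ)‖ ^ (p - 4) : ℝ) : ℂ) * conj (0 : ℂ) ^ 2 = 0 := by simp
    rw [ContinuousAt, hz]
    refine squeeze_zero_norm (fun ζ => ?_) hlim
    by_cases h : ζ = 0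
    · simp [h, Real.zero_rpow (by linarith : p - 2 ≠ 0)]
    · have hn' : 0 < ‖ζ‖ := norm_pos_iff.2 h
      have h7 : ‖ζ‖ ^ (p - 2) = ‖ζ‖ ^ (p - 4) * ‖ζ‖ ^ 2 := by
        rw [← Real.rpow_natCast, ← Real.rpow_add hn']
        congr 1; push_cast; ring
      rw [h7]
      simp only [norm_mul, norm_pow, RCLike.norm_conj, Complex.norm_real]
      rw [Real.norm_of_nonneg (by positivity)]
  · apply ContinuousAt.mul
    · apply Complex.continuous_ofReal.continuousAt.comp
      exact continuousAt_id.norm.rpow_const (Or.inl (by simpa using h0))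
    · fun_prop

lemma isOpen_unitDisk : IsOpen unitDisk := Metric.isOpen_ball

lemma hasDerivAt_of_differentiableOn_unitDisk {f : ℂ → ℂ} (hf : DifferentiableOn ℂ f unitDisk)
    {z : ℂ} (hz : z ∈ unitDisk) : HasDerivAt f (deriv f z) z :=
  (hf.differentiableAt (isOpen_unitDisk.mem_nhds hz)).hasDerivAt

lemma hasWirtinger_norm_rpow {f : ℂ → ℂ} (hf : DifferentiableOn ℂ f unitDisk) {p : ℝ}
    (hp : 2 < p) :
    HasWirtinger (fun z => ((‖f z‖ ^ p : ℝ) : ℂ))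
      (fun z => p / 2 * (((‖f z‖ ^ (p - 2) : ℝ) : ℂ) * conj (f z) * deriv f z))
      (fun z => p / 2 * conj (((‖f z‖ ^ (p - 2) : ℝ) : ℂ) * conj (f z) * deriv f z)) := by
  intro γ v t ht hγ
  have h1 := (hasDerivAt_of_differentiableOn_unitDisk hf ht).scomp t hγ
  have h2 := (h1.norm_rpow_complex (by linarith : 1 < p)).ofReal_comp
  refine h2.congr_deriv ?_
  have h9 : ((conj (f (γ t)) * (v • deriv f (γ t))).re : ℂ) =
      (conj (f (γ t)) * v * deriv f (γ t) + conj (conj (f (γ t)) * v * deriv f (γ t))) / 2 := by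
    rw [Complex.add_conj]; simp [mul_assoc]
  simp only [Complex.ofReal_mul, Function.comp_apply, h9]
  simp only [map_mul, Complex.conj_ofReal]
  ring

lemma hasWirtinger_mul_deriv {f : ℂ → ℂ} (hf : DifferentiableOn ℂ f unitDisk) {p : ℝ}
    (hp : 2 < p) :
    HasWirtinger (fun z => z * deriv f z * (((‖f z‖ ^ (p - 2) : ℝ) : ℂ) * conj (f z)))
      (fun z => (deriv f z + z * deriv (deriv f) z) * (((‖f z‖ ^ (p - 2) : ℝ) : ℂ) * conj (f z)) +
        z * deriv f z * ((p - 2) / 2 * (((‖f z‖ ^ (p - 4) : ℝ) : ℂ) * conj (f z) ^ 2) * deriv f z))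
      (fun z => z * deriv f z * (p / 2 * ((‖f z‖ ^ (p - 2) : ℝ) : ℂ) * conj (deriv f z))) := by
  intro γ v t ht hγ
  have hf' : DifferentiableOn ℂ (deriv f) unitDisk := hf.deriv isOpen_unitDisk
  have h1 := (hasDerivAt_of_differentiableOn_unitDisk hf ht).scomp t hγ
  have h2 := (hasDerivAt_of_differentiableOn_unitDisk hf' ht).scomp t hγ
  have h3 := (hγ.mul h2).mul (hasDerivAt_norm_rpow_mul_conj hp h1)
  refine h3.congr_deriv ?_
  simp only [Function.comp_apply, smul_eq_mul, map_mul, Pi.mul_apply]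
  ring

/-- The Hardy–Stein identity. -/
lemma hardy_stein {f : ℂ → ℂ} (hf : DifferentiableOn ℂ f unitDisk) {p : ℝ} (hp : 2 < p) {r : ℝ}
    (hr0 : 0 ≤ r) (hr1 : r < 1) :
    ∫ θ in -Real.pi..Real.pi, ‖f (r * Complex.exp (θ * Complex.I))‖ ^ p =
      2 * Real.pi * ‖f 0‖ ^ p + ∫ s in (0 : ℝ)..r, p ^ 2 / s * ∫ σ in (0 : ℝ)..s,
        σ * ∫ θ in -Real.pi..Real.pi, ‖deriv f (σ * Complex.exp (θ * Complex.I))‖ ^ 2 *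
          ‖f (σ * Complex.exp (θ * Complex.I))‖ ^ (p - 2) := by
  have hfc : ContinuousOn f unitDisk := hf.continuousOn
  have hf' : DifferentiableOn ℂ (deriv f) unitDisk := hf.deriv isOpen_unitDisk
  have hf'c : ContinuousOn (deriv f) unitDisk := hf'.continuousOn
  have hf''c : ContinuousOn (deriv (deriv f)) unitDisk := (hf'.deriv isOpen_unitDisk).continuousOn
  have hn : ContinuousOn (fun z => ((‖f z‖ ^ (p - 2) : ℝ) : ℂ)) unitDisk :=
    Complex.continuous_ofReal.comp_continuousOn
      (hfc.norm.rpow_const fun _ _ => Or.inr (by linarith))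
  have hcf : ContinuousOn (fun z => conj (f z)) unitDisk := Complex.continuous_conj.comp_continuousOn hfc
  have hcf' : ContinuousOn (fun z => conj (deriv f z)) unitDisk :=
    Complex.continuous_conj.comp_continuousOn hf'c
  have hn2 : ContinuousOn (fun z => ((‖f z‖ ^ (p - 4) : ℝ) : ℂ) * conj (f z) ^ 2) unitDisk :=
    (continuous_norm_rpow_mul_conj_sq hp).comp_continuousOn hfc
  have hU := (hasWirtinger_norm_rpow hf hp).integral_circle (by fun_prop)
    (continuousOn_const.mul (Complex.continuous_conj.comp_continuousOn (by fun_prop))) hr0 hr1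
  have hW := fun (s : ℝ) (hs0 : 0 ≤ s) (hs1 : s < 1) =>
    (hasWirtinger_mul_deriv hf hp).integral_circle (by fun_prop) (by fun_prop) hs0 hs1
  have key : ∀ s : ℝ, 0 < s → s < 1 → 2 * ∫ θ in -Real.pi..Real.pi,
      (p / 2 * conj (((‖f (s * Complex.exp (θ * Complex.I))‖ ^ (p - 2) : ℝ) : ℂ) *
        conj (f (s * Complex.exp (θ * Complex.I))) * deriv f (s * Complex.exp (θ * Complex.I)))) *
        Complex.exp (-(θ * Complex.I)) =
      ((p ^ 2 / s * ∫ σ in (0 : ℝ)..s,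
        σ * ∫ θ in -Real.pi..Real.pi, ‖deriv f (σ * Complex.exp (θ * Complex.I))‖ ^ 2 *
          ‖f (σ * Complex.exp (θ * Complex.I))‖ ^ (p - 2) : ℝ) : ℂ) := by
    intro s hs0 hs1
    have h1 := hW s hs0.le hs1
    have h2 : ∀ σ θ : ℝ, (σ : ℂ) * Complex.exp (θ * Complex.I) *
          deriv f (σ * Complex.exp (θ * Complex.I)) *
          (p / 2 * ((‖f (σ * Complex.exp (θ * Complex.I))‖ ^ (p - 2) : ℝ) : ℂ) *
            conj (deriv f (σ * Complex.exp (θ * Complex.I)))) * Complex.exp (-(θ * Complex.I)) =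
        ((p / 2 * σ * (‖deriv f (σ * Complex.exp (θ * Complex.I))‖ ^ 2 *
          ‖f (σ * Complex.exp (θ * Complex.I))‖ ^ (p - 2)) : ℝ) : ℂ) := by
      intro σ θ
      have e1 : Complex.exp (θ * Complex.I) * Complex.exp (-(θ * Complex.I)) = 1 := by
        rw [← Complex.exp_add]; simp
      have e2 := Complex.mul_conj (deriv f (σ * Complex.exp (θ * Complex.I)))
      rw [Complex.normSq_eq_norm_sq] at e2
      simp only [Complex.ofReal_mul, ← e2]
      push_cast
      linear_combination ((σ : ℂ) * deriv f (σ * Complex.exp (θ * Complex.I)) *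
          (p / 2 * ((‖f (σ * Complex.exp (θ * Complex.I))‖ ^ (p - 2) : ℝ) : ℂ) *
            conj (deriv f (σ * Complex.exp (θ * Complex.I))))) * e1
    simp_rw [h2] at h1
    have h3 : ∀ θ : ℝ, (p / 2 * conj (((‖f (s * Complex.exp (θ * Complex.I))‖ ^ (p - 2) : ℝ) : ℂ) *
        conj (f (s * Complex.exp (θ * Complex.I))) * deriv f (s * Complex.exp (θ * Complex.I)))) *
        Complex.exp (-(θ * Complex.I)) = (p / 2 / s : ℂ) * conj (s * Complex.exp (θ * Complex.I) *
          deriv f (s * Complex.exp (θ * Complex.I)) *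
          (((‖f (s * Complex.exp (θ * Complex.I))‖ ^ (p - 2) : ℝ) : ℂ) *
            conj (f (s * Complex.exp (θ * Complex.I))))) := by
      intro θ
      have : (s : ℂ) ≠ 0 := by exact_mod_cast hs0.ne'
      rw [← conj_exp_I]
      simp only [map_mul, Complex.conj_ofReal]
      field_simp
    simp_rw [h3]
    rw [intervalIntegral.integral_const_mul]
    have h4 : ∀ g : ℝ → ℂ, ∫ θ in -Real.pi..Real.pi, conj (g θ) =
        conj (∫ θ in -Real.pi..Real.pi, g θ) := by
      intro g
      simp only [intervalIntegral, integral_conj, map_sub]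
    rw [h4, h1]
    simp only [intervalIntegral.integral_ofReal, intervalIntegral.integral_const_mul]
    simp only [mul_assoc (p / 2), intervalIntegral.integral_const_mul]
    simp only [zero_mul, mul_zero, zero_add, map_mul, Complex.conj_ofReal, Complex.conj_ofNat]
    push_cast
    ring
  have h6 : ∫ s in (0 : ℝ)..r, 2 * ∫ θ in -Real.pi..Real.pi,
      (p / 2 * conj (((‖f (s * Complex.exp (θ * Complex.I))‖ ^ (p - 2) : ℝ) : ℂ) *
        conj (f (s * Complex.exp (θ * Complex.I))) * deriv f (s * Complex.exp (θ * Complex.I)))) *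
        Complex.exp (-(θ * Complex.I)) = ∫ s in (0 : ℝ)..r, ((p ^ 2 / s * ∫ σ in (0 : ℝ)..s,
        σ * ∫ θ in -Real.pi..Real.pi, ‖deriv f (σ * Complex.exp (θ * Complex.I))‖ ^ 2 *
          ‖f (σ * Complex.exp (θ * Complex.I))‖ ^ (p - 2) : ℝ) : ℂ) := by
    apply intervalIntegral.integral_congr_ae
    refine Eventually.of_forall fun s hs => ?_
    rw [uIoc_of_le hr0] at hs
    exact key s hs.1 (hs.2.trans_lt hr1)
  rw [h6, intervalIntegral.integral_ofReal, intervalIntegral.integral_ofReal] at hU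
  exact_mod_cast hU

lemma ofReal_intervalIntegral_eq_lintegral {g : ℝ → ℝ} {a b : ℝ} (hab : a ≤ b)
    (hg : IntegrableOn g (Ioo a b)) (h0 : ∀ x ∈ Ioo a b, 0 ≤ g x) :
    ENNReal.ofReal (∫ x in a..b, g x) = ∫⁻ x in Ioo a b, ENNReal.ofReal (g x) := by
  rw [intervalIntegral.integral_of_le hab, integral_Ioc_eq_integral_Ioo,
    ofReal_integral_eq_lintegral_ofReal hg]
  exact (ae_restrict_iff' measurableSet_Ioo).2 (Eventually.of_forall h0)

lemma ofReal_iterated_integral {k : ℝ → ℝ → ℝ} (hk : Continuous (Function.uncurry k))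
    (hk0 : ∀ σ θ, 0 ≤ k σ θ) (p : ℝ) {r : ℝ} (hr : 0 ≤ r) :
    0 ≤ (∫ s in (0 : ℝ)..r, p ^ 2 / s * ∫ σ in (0 : ℝ)..s,
        σ * ∫ θ in -Real.pi..Real.pi, k σ θ) ∧
    ENNReal.ofReal (∫ s in (0 : ℝ)..r, p ^ 2 / s * ∫ σ in (0 : ℝ)..s,
        σ * ∫ θ in -Real.pi..Real.pi, k σ θ) =
      ∫⁻ s in Ioo 0 r, ENNReal.ofReal (p ^ 2 / s) * ∫⁻ σ in Ioo 0 s, ENNReal.ofReal σ *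
        ∫⁻ θ in Ioo (-Real.pi) Real.pi, ENNReal.ofReal (k σ θ) := by
  have hpi : -Real.pi ≤ Real.pi := by linarith [Real.pi_pos]
  set y : ℝ → ℝ := fun σ => ∫ θ in -Real.pi..Real.pi, k σ θ with hy
  have hyc : Continuous y := intervalIntegral.continuous_parametric_intervalIntegral_of_continuous' hk _ _
  have hy0 : ∀ σ, 0 ≤ y σ := fun σ => intervalIntegral.integral_nonneg hpi fun θ _ => hk0 σ θ
  have hy1 : ∀ σ, ENNReal.ofReal (y σ) = ∫⁻ θ in Ioo (-Real.pi) Real.pi, ENNReal.ofReal (k σ θ) := by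
    intro σ
    refine ofReal_intervalIntegral_eq_lintegral hpi ?_ fun θ _ => hk0 σ θ
    exact ((hk.comp (by fun_prop : Continuous fun θ : ℝ => (σ, θ))).integrableOn_Icc).mono_set
      Ioo_subset_Icc_self
  set b : ℝ → ℝ := fun s => ∫ σ in (0 : ℝ)..s, σ * y σ with hb
  have hbc : Continuous b := intervalIntegral.continuous_primitive
    (fun _ _ => (continuous_id.mul hyc).intervalIntegrable _ _) 0
  have hb0 : ∀ s, 0 ≤ s → 0 ≤ b s := fun s hs =>
    intervalIntegral.integral_nonneg hs fun σ hσ => mul_nonneg hσ.1 (hy0 σ)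
  have hb1 : ∀ s, 0 ≤ s → ENNReal.ofReal (b s) = ∫⁻ σ in Ioo 0 s, ENNReal.ofReal σ *
        ∫⁻ θ in Ioo (-Real.pi) Real.pi, ENNReal.ofReal (k σ θ) := by
    intro s hs
    have hyc' : Continuous fun σ : ℝ => σ * y σ := continuous_id.mul hyc
    refine (ofReal_intervalIntegral_eq_lintegral hs
      (hyc'.integrableOn_Icc.mono_set Ioo_subset_Icc_self)
      fun σ hσ => mul_nonneg hσ.1.le (hy0 σ)).trans ?_
    refine setLIntegral_congr_fun measurableSet_Ioo fun σ hσ => ?_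
    simp only [← hy1]
    rw [ENNReal.ofReal_mul hσ.1.le]
  have hnn : ∀ s ∈ Ioo 0 r, 0 ≤ p ^ 2 / s * b s := fun s hs =>
    mul_nonneg (div_nonneg (sq_nonneg _) hs.1.le) (hb0 s hs.1.le)
  obtain ⟨B, hB⟩ := isCompact_Icc.exists_bound_of_continuousOn (s := Icc 0 r) hyc.continuousOn
  have hint : IntegrableOn (fun s => p ^ 2 / s * b s) (Ioo 0 r) := by
    refine Measure.integrableOn_of_bounded (M := p ^ 2 * (B * r)) (by simp) ?_ ?_
    · exact (by fun_prop : Measurable fun s => p ^ 2 / s * b s).aestronglyMeasurable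
    · refine (ae_restrict_iff' measurableSet_Ioo).2 (Eventually.of_forall fun s hs => ?_)
      rw [Real.norm_of_nonneg (hnn s hs)]
      have h1 : b s ≤ s * (B * r) := by
        have : b s ≤ ∫ σ in (0 : ℝ)..s, r * B := by
          refine intervalIntegral.integral_mono_on hs.1.le
            ((continuous_id.mul hyc).intervalIntegrable _ _) (by simp) fun σ hσ => ?_
          have hσr : σ ∈ Icc 0 r := ⟨hσ.1, hσ.2.trans hs.2.le⟩
          have h2 := (le_abs_self _).trans (hB σ hσr)
          exact mul_le_mul hσr.2 h2 (hy0 σ) hr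
        rw [intervalIntegral.integral_const] at this
        simp only [sub_zero, smul_eq_mul] at this
        linarith
      calc p ^ 2 / s * b s ≤ p ^ 2 / s * (s * (B * r)) :=
            mul_le_mul_of_nonneg_left h1 (div_nonneg (sq_nonneg _) hs.1.le)
        _ = p ^ 2 * (B * r) := by have := hs.1.ne'; field_simp
  refine ⟨?_, ?_⟩
  · rw [intervalIntegral.integral_of_le hr, integral_Ioc_eq_integral_Ioo]
    exact setIntegral_nonneg measurableSet_Ioo hnn
  · rw [ofReal_intervalIntegral_eq_lintegral hr hint hnn]
    refine setLIntegral_congr_fun measurableSet_Ioo fun s hs => ?_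
    rw [ENNReal.ofReal_mul (div_nonneg (sq_nonneg _) hs.1.le), hb1 s hs.1.le]

/-- The Hardy–Stein identity in terms of Lebesgue integrals. -/
lemma hardy_stein_lintegral {f : ℂ → ℂ} (hf : DifferentiableOn ℂ f unitDisk) {p : ℝ} (hp : 2 < p)
    {r : ℝ} (hr0 : 0 ≤ r) (hr1 : r < 1) :
    ∫⁻ θ in Ioo (-Real.pi) Real.pi, ENNReal.ofReal (‖f (r * Complex.exp (θ * Complex.I))‖ ^ p) =
      ENNReal.ofReal (2 * Real.pi * ‖f 0‖ ^ p) + ∫⁻ s in Ioo 0 r, ENNReal.ofReal (p ^ 2 / s) *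
        ∫⁻ σ in Ioo 0 s, ENNReal.ofReal σ * ∫⁻ θ in Ioo (-Real.pi) Real.pi,
          ENNReal.ofReal (‖deriv f (σ * Complex.exp (θ * Complex.I))‖ ^ 2 *
          ‖f (σ * Complex.exp (θ * Complex.I))‖ ^ (p - 2)) := by
  have hpi : -Real.pi ≤ Real.pi := by linarith [Real.pi_pos]
  have hfc : ContinuousOn f unitDisk := hf.continuousOn
  have hf'c : ContinuousOn (deriv f) unitDisk := (hf.deriv isOpen_unitDisk).continuousOn
  set c : ℝ → ℝ := fun σ => max 0 (min σ r) with hc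
  have hcmem : ∀ x : ℝ × ℝ, (c x.1 : ℂ) * Complex.exp (x.2 * Complex.I) ∈ unitDisk := by
    intro x
    apply real_mul_exp_I_mem_unitDisk
    rw [abs_of_nonneg (le_max_left _ _)]
    exact max_lt (by norm_num) ((min_le_right _ _).trans_lt hr1)
  have hcc : Continuous c := by fun_prop
  have hceq : ∀ σ, 0 ≤ σ → σ ≤ r → c σ = σ := fun σ h0 h1 => by simp [hc, h0, h1]
  set k : ℝ → ℝ → ℝ := fun σ θ => ‖deriv f (c σ * Complex.exp (θ * Complex.I))‖ ^ 2 *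
          ‖f (c σ * Complex.exp (θ * Complex.I))‖ ^ (p - 2) with hk
  have hpol : Continuous fun x : ℝ × ℝ => (c x.1 : ℂ) * Complex.exp (x.2 * Complex.I) := by
    fun_prop
  have hkc : Continuous (Function.uncurry k) := by
    apply Continuous.mul
    · exact (hf'c.comp_continuous hpol hcmem).norm.pow 2
    · exact (hfc.comp_continuous hpol hcmem).norm.rpow_const fun _ => Or.inr (by linarith)
  obtain ⟨h0, h1⟩ := ofReal_iterated_integral hkc (fun σ θ => by positivity) p hr0
  have hHS := hardy_stein hf hp hr0 hr1
  have h2 : (∫ s in (0 : ℝ)..r, p ^ 2 / s * ∫ σ in (0 : ℝ)..s,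
        σ * ∫ θ in -Real.pi..Real.pi, k σ θ) = ∫ s in (0 : ℝ)..r, p ^ 2 / s * ∫ σ in (0 : ℝ)..s,
        σ * ∫ θ in -Real.pi..Real.pi, ‖deriv f (σ * Complex.exp (θ * Complex.I))‖ ^ 2 *
          ‖f (σ * Complex.exp (θ * Complex.I))‖ ^ (p - 2) := by
    refine intervalIntegral.integral_congr fun s hs => ?_
    rw [uIcc_of_le hr0] at hs
    congr 1
    refine intervalIntegral.integral_congr fun σ hσ => ?_
    rw [uIcc_of_le hs.1] at hσ
    simp only [hk, hceq σ hσ.1 (hσ.2.trans hs.2)]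
  have h3 : ∫⁻ θ in Ioo (-Real.pi) Real.pi,
      ENNReal.ofReal (‖f (r * Complex.exp (θ * Complex.I))‖ ^ p) =
      ENNReal.ofReal (∫ θ in -Real.pi..Real.pi, ‖f (r * Complex.exp (θ * Complex.I))‖ ^ p) := by
    rw [ofReal_intervalIntegral_eq_lintegral hpi _ fun θ _ => by positivity]
    have : Continuous fun θ : ℝ => ‖f (r * Complex.exp (θ * Complex.I))‖ ^ p := by
      refine (hfc.comp_continuous (by fun_prop) fun θ => ?_).norm.rpow_const
        fun _ => Or.inr (by linarith)
      exact real_mul_exp_I_mem_unitDisk (by rwa [abs_of_nonneg hr0]) θ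
    exact this.integrableOn_Icc.mono_set Ioo_subset_Icc_self
  rw [h3, hHS, ← h2, ENNReal.ofReal_add (by positivity) h0, h1]
  congr 1
  refine setLIntegral_congr_fun measurableSet_Ioo fun s hs => ?_
  congr 1
  refine setLIntegral_congr_fun measurableSet_Ioo fun σ hσ => ?_
  simp only [hk, hceq σ hσ.1.le (hσ.2.le.trans hs.2.le)]

lemma lintegral_unitDisk_polar {g : ℂ → ℝ≥0∞} (hg : Measurable g) :
    ∫⁻ z in unitDisk, g z = ∫⁻ r in Ioo (0 : ℝ) 1, ENNReal.ofReal r *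
      ∫⁻ θ in Ioo (-Real.pi) Real.pi, g (r * Complex.exp (θ * Complex.I)) := by
  rw [← lintegral_indicator isOpen_unitDisk.measurableSet, ← Complex.lintegral_comp_polarCoord_symm]
  have hm : Measurable (unitDisk.indicator g) := hg.indicator isOpen_unitDisk.measurableSet
  have hsymm : ∀ x : ℝ × ℝ, Complex.polarCoord.symm x =
      (x.1 : ℂ) * Complex.exp (x.2 * Complex.I) := by
    intro x
    rw [Complex.polarCoord_symm_apply, Complex.exp_mul_I]
    push_cast; rfl
  simp_rw [hsymm, polarCoord_target]
  rw [Measure.volume_eq_prod, ← Measure.prod_restrict, lintegral_prod]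
  · simp only [smul_eq_mul]
    have h1 : ∀ r ∈ Ioi (0 : ℝ), (∫⁻ θ in Ioo (-Real.pi) Real.pi, ENNReal.ofReal r *
        unitDisk.indicator g (r * Complex.exp (θ * Complex.I))) =
        (Ioo (0 : ℝ) 1).indicator (fun r => ENNReal.ofReal r *
          ∫⁻ θ in Ioo (-Real.pi) Real.pi, g (r * Complex.exp (θ * Complex.I))) r := by
      intro r hr
      rw [lintegral_const_mul _ (show Measurable fun θ : ℝ =>
        unitDisk.indicator g (r * Complex.exp (θ * Complex.I)) from hm.comp (by fun_prop))]
      by_cases h : r < 1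
      · rw [indicator_of_mem (show r ∈ Ioo (0 : ℝ) 1 from ⟨hr, h⟩)]
        congr 1
        refine lintegral_congr fun θ => ?_
        rw [indicator_of_mem]
        exact real_mul_exp_I_mem_unitDisk (by rwa [abs_of_pos hr]) θ
      · rw [indicator_of_notMem (fun h' => h h'.2)]
        have : ∀ θ : ℝ, unitDisk.indicator g (r * Complex.exp (θ * Complex.I)) = 0 := by
          intro θ
          apply indicator_of_notMem
          rw [mem_unitDisk_iff, norm_real_mul_exp_I, abs_of_pos hr]
          exact h
        simp [this]
    rw [setLIntegral_congr_fun measurableSet_Ioi h1, setLIntegral_indicator measurableSet_Ioo]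
    congr 2
    ext x; simp; tauto
  · refine (Measurable.mul (by fun_prop) (hm.comp (by fun_prop))).aemeasurable

lemma lintegral_triangle_swap {w A : ℝ → ℝ≥0∞} (hw : Measurable w) (hA : Measurable A) :
    ∫⁻ r in Ioo (0 : ℝ) 1, w r * ∫⁻ s in Ioo 0 r, A s =
      ∫⁻ s in Ioo (0 : ℝ) 1, A s * ∫⁻ r in Ioo s 1, w r := by
  set T : ℝ → ℝ → ℝ≥0∞ := fun r s => {x : ℝ × ℝ | x.2 < x.1}.indicator (fun x => w x.1 * A x.2) (r, s)
  have hT : Measurable (Function.uncurry T) :=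
    Measurable.indicator (by fun_prop) (measurableSet_lt measurable_snd measurable_fst)
  have h1 : ∀ r ∈ Ioo (0 : ℝ) 1, w r * ∫⁻ s in Ioo 0 r, A s = ∫⁻ s in Ioo (0 : ℝ) 1, T r s := by
    intro r hr
    rw [← lintegral_const_mul _ hA, ← lintegral_indicator measurableSet_Ioo,
      ← lintegral_indicator measurableSet_Ioo]
    refine lintegral_congr fun s => ?_
    simp only [indicator, mem_Ioo, mem_ofPred_eq, T]
    have := hr.2
    split_ifs <;> first | rfl | (exfalso; grind)
  have h2 : ∀ s ∈ Ioo (0 : ℝ) 1, A s * ∫⁻ r in Ioo s 1, w r = ∫⁻ r in Ioo (0 : ℝ) 1, T r s := by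
    intro s hs
    rw [← lintegral_const_mul _ hw, ← lintegral_indicator measurableSet_Ioo,
      ← lintegral_indicator measurableSet_Ioo]
    refine lintegral_congr fun r => ?_
    simp only [indicator, mem_Ioo, mem_ofPred_eq, T]
    have := hs.1
    split_ifs <;> first | rfl | exact mul_comm _ _ | (exfalso; grind)
  rw [setLIntegral_congr_fun measurableSet_Ioo h1, setLIntegral_congr_fun measurableSet_Ioo h2]
  exact lintegral_lintegral_swap hT.aemeasurable

lemma lintegral_radial_weight {a s : ℝ} (ha : 0 < a) (hs0 : 0 ≤ s) (hs1 : s < 1) :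
    ∫⁻ r in Ioo s 1, ENNReal.ofReal (r * (1 - r ^ 2) ^ (a - 1)) =
      ENNReal.ofReal ((1 - s ^ 2) ^ a / (2 * a)) := by
  have hderiv : ∀ x ∈ Ioo s 1, HasDerivAt (fun r : ℝ => -((1 - r ^ 2) ^ a / (2 * a)))
      (x * (1 - x ^ 2) ^ (a - 1)) x := by
    intro x hx
    have hx2 : 0 < 1 - x ^ 2 := by nlinarith [hx.1, hx.2]
    have h1 : HasDerivAt (fun r : ℝ => 1 - r ^ 2) (-(2 * x)) x := by
      simpa using (hasDerivAt_pow 2 x).const_sub 1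
    have h2 := ((h1.rpow_const (p := a) (Or.inl hx2.ne')).div_const (2 * a)).neg
    refine h2.congr_deriv ?_
    field_simp
  have hcont : ContinuousOn (fun r : ℝ => -((1 - r ^ 2) ^ a / (2 * a))) (Icc s 1) :=
    (((by fun_prop : Continuous fun r : ℝ => 1 - r ^ 2).rpow_const
      fun _ => Or.inr ha.le).div_const _).neg.continuousOn
  have hnn : ∀ x ∈ Ioo s 1, 0 ≤ x * (1 - x ^ 2) ^ (a - 1) := by
    intro x hx
    have hx2 : 0 < 1 - x ^ 2 := by nlinarith [hx.1, hx.2]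
    have : 0 < x := by linarith [hx.1]
    positivity
  have hint := intervalIntegral.integrableOn_deriv_of_nonneg hcont hderiv hnn
  have hFTC := intervalIntegral.integral_eq_sub_of_hasDerivAt_of_le hs1.le hcont hderiv
    ((intervalIntegrable_iff_integrableOn_Ioc_of_le hs1.le).2 hint)
  rw [← ofReal_intervalIntegral_eq_lintegral hs1.le (hint.mono_set Ioo_subset_Ioc_self) hnn, hFTC]
  congr 1
  simp [Real.zero_rpow ha.ne']

/-- The series `∑ ρ^(q+n)/(q+n)`. -/
def logSeries (q ρ : ℝ) : ℝ≥0∞ := ∑' n : ℕ, ENNReal.ofReal (ρ ^ (q + n) / (q + n))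

lemma measurable_logSeries (q : ℝ) : Measurable (logSeries q) := by
  unfold logSeries
  fun_prop

lemma ofReal_inv_mul_rpow_eq_tsum {q s : ℝ} (hs0 : 0 < s) (hs1 : s < 1) :
    ENNReal.ofReal (1 / s * (1 - s ^ 2) ^ (q - 1)) =
      ∑' n : ℕ, ENNReal.ofReal (s * (1 - s ^ 2) ^ (q + n - 1)) := by
  have hx0 : 0 < 1 - s ^ 2 := by nlinarith
  have hx1 : 1 - s ^ 2 < 1 := by nlinarith
  have h : HasSum (fun n : ℕ => s * (1 - s ^ 2) ^ (q + n - 1)) (1 / s * (1 - s ^ 2) ^ (q - 1)) := by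
    have h1 := (hasSum_geometric_of_lt_one hx0.le hx1).mul_left (s * (1 - s ^ 2) ^ (q - 1))
    have h2 : s * (1 - s ^ 2) ^ (q - 1) * (1 - (1 - s ^ 2))⁻¹ =
        1 / s * (1 - s ^ 2) ^ (q - 1) := by
      rw [sub_sub_cancel]; field_simp
    rw [h2] at h1
    refine h1.congr_fun fun n => ?_
    rw [show q + n - 1 = (q - 1) + n by ring, Real.rpow_add hx0, Real.rpow_natCast]
    ring
  rw [← h.tsum_eq, ENNReal.ofReal_tsum_of_nonneg (fun n => by positivity) h.summable]

lemma lintegral_inv_mul_rpow {q s : ℝ} (hq : 1 < q) (hs0 : 0 ≤ s) (hs1 : s < 1) :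
    ∫⁻ r in Ioo s 1, ENNReal.ofReal (1 / r * (1 - r ^ 2) ^ (q - 1)) =
      ENNReal.ofReal (1 / 2) * logSeries q (1 - s ^ 2) := by
  have h1 : ∀ r ∈ Ioo s 1, ENNReal.ofReal (1 / r * (1 - r ^ 2) ^ (q - 1)) =
      ∑' n : ℕ, ENNReal.ofReal (r * (1 - r ^ 2) ^ (q + n - 1)) := fun r hr =>
    ofReal_inv_mul_rpow_eq_tsum (hs0.trans_lt hr.1) hr.2
  rw [setLIntegral_congr_fun measurableSet_Ioo h1, lintegral_tsum (fun n => by fun_prop),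
    logSeries, ← ENNReal.tsum_mul_left]
  congr 1; ext1 n
  rw [lintegral_radial_weight (by positivity) hs0 hs1, ← ENNReal.ofReal_mul (by norm_num)]
  congr 1; field_simp

lemma lintegral_norm_rpow_eq {f : ℂ → ℂ} (hf : DifferentiableOn ℂ f unitDisk) {p q : ℝ}
    (hp : 2 < p) (hq : 1 < q) :
    ENNReal.ofReal (q - 1) *
      ∫⁻ z in unitDisk, ENNReal.ofReal ((1 - ‖z‖ ^ 2) ^ (q - 2) * ‖f z‖ ^ p) =
    ENNReal.ofReal (Real.pi * ‖f 0‖ ^ p) + ENNReal.ofReal (p ^ 2 / 4) *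
      ∫⁻ z in unitDisk, ENNReal.ofReal (‖deriv f z‖ ^ 2 * ‖f z‖ ^ (p - 2)) *
        logSeries q (1 - ‖z‖ ^ 2) := by
  have hU := isOpen_unitDisk.measurableSet
  set F := unitDisk.indicator f with hF
  set F' := unitDisk.indicator (deriv f) with hF'
  have hFm : Measurable F := by
    classical
    rw [hF, ← piecewise_eq_indicator]
    exact hf.continuousOn.measurable_piecewise continuousOn_const hU
  have hF'm : Measurable F' := (measurable_deriv f).indicator hU
  have hFe : ∀ z ∈ unitDisk, F z = f z := fun z hz => indicator_of_mem hz f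
  have hF'e : ∀ z ∈ unitDisk, F' z = deriv f z := fun z hz => indicator_of_mem hz (deriv f)
  have hpolm : ∀ {σ : ℝ} (_ : σ ∈ Ioo (0 : ℝ) 1) (θ : ℝ),
      (σ : ℂ) * Complex.exp (θ * Complex.I) ∈ unitDisk := fun hσ θ =>
    real_mul_exp_I_mem_unitDisk (by rw [abs_of_pos hσ.1]; exact hσ.2) θ
  set Y : ℂ → ℝ≥0∞ := fun z => ENNReal.ofReal (‖F' z‖ ^ 2 * ‖F z‖ ^ (p - 2)) with hY
  have hYm : Measurable Y := by fun_prop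
  set c : ℝ → ℝ≥0∞ := fun σ => ENNReal.ofReal σ * ∫⁻ θ in Ioo (-Real.pi) Real.pi,
    Y (σ * Complex.exp (θ * Complex.I)) with hc
  have hcm : Measurable c := by
    refine Measurable.mul (by fun_prop) (Measurable.lintegral_prod_right' (f := fun x : ℝ × ℝ =>
      Y (x.1 * Complex.exp (x.2 * Complex.I))) (hYm.comp (by fun_prop)))
  have hBm : Measurable fun s : ℝ => ∫⁻ σ in Ioo 0 s, c σ :=
    Monotone.measurable fun a b hab => lintegral_mono_set (Ioo_subset_Ioo_right hab)
  set w : ℝ → ℝ≥0∞ := fun r => ENNReal.ofReal (r * (1 - r ^ 2) ^ ((q - 1) - 1)) with hw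
  set A : ℝ → ℝ≥0∞ := fun s => ENNReal.ofReal (p ^ 2 / s) * ∫⁻ σ in Ioo 0 s, c σ with hA
  have hAm : Measurable A := Measurable.mul (by fun_prop) hBm
  have hwm : Measurable w := by fun_prop
  -- left side
  have hL : ∫⁻ z in unitDisk, ENNReal.ofReal ((1 - ‖z‖ ^ 2) ^ (q - 2) * ‖f z‖ ^ p) =
      ∫⁻ r in Ioo (0 : ℝ) 1, (w r * ENNReal.ofReal (2 * Real.pi * ‖f 0‖ ^ p) +
        w r * ∫⁻ s in Ioo 0 r, A s) := by
    rw [setLIntegral_congr_fun (g := fun z =>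
      ENNReal.ofReal ((1 - ‖z‖ ^ 2) ^ (q - 2) * ‖F z‖ ^ p)) hU fun z hz => by
        simp only [hFe z hz],
      lintegral_unitDisk_polar (by fun_prop)]
    refine setLIntegral_congr_fun measurableSet_Ioo fun r hr => ?_
    have hr2 : 0 < 1 - r ^ 2 := by nlinarith [hr.1, hr.2]
    have h1 : ∀ θ : ℝ, ENNReal.ofReal ((1 - ‖(r : ℂ) * Complex.exp (θ * Complex.I)‖ ^ 2) ^ (q - 2) *
        ‖F (r * Complex.exp (θ * Complex.I))‖ ^ p) = ENNReal.ofReal ((1 - r ^ 2) ^ (q - 2)) *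
        ENNReal.ofReal (‖f (r * Complex.exp (θ * Complex.I))‖ ^ p) := by
      intro θ
      rw [hFe _ (hpolm hr θ), norm_real_mul_exp_I, sq_abs, ENNReal.ofReal_mul (by positivity)]
    simp only [h1]
    rw [lintegral_const_mul' _ _ ENNReal.ofReal_ne_top, hardy_stein_lintegral hf hp hr.1.le hr.2,
      ← mul_assoc, ← ENNReal.ofReal_mul hr.1.le, ← mul_add]
    have h2 : q - 1 - 1 = q - 2 := by ring
    simp only [hw, h2]
    congr 2
    refine setLIntegral_congr_fun measurableSet_Ioo fun s hs => ?_
    simp only [hA]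
    congr 1
    refine setLIntegral_congr_fun measurableSet_Ioo fun σ hσ => ?_
    simp only [hc, hY]
    congr 1
    refine lintegral_congr fun θ => ?_
    have := hpolm (σ := σ) ⟨hσ.1, (hσ.2.trans hs.2).trans hr.2⟩ θ
    rw [hFe _ this, hF'e _ this]
  have hV : ∀ s ∈ Ioo (0 : ℝ) 1, A s * ∫⁻ r in Ioo s 1, w r =
      (ENNReal.ofReal (p ^ 2 / (2 * (q - 1))) * ENNReal.ofReal (1 / s * (1 - s ^ 2) ^ (q - 1))) *
        ∫⁻ σ in Ioo 0 s, c σ := by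
    intro s hs
    have hs2 : 0 < 1 - s ^ 2 := by nlinarith [hs.1, hs.2]
    have hs0 := hs.1
    have hq1 : 0 < q - 1 := by linarith
    rw [lintegral_radial_weight (by linarith) hs.1.le hs.2]
    simp only [hA]
    rw [mul_right_comm, ← ENNReal.ofReal_mul (by positivity), ← ENNReal.ofReal_mul (by positivity)]
    congr 2
    field_simp
  have hq1 : 0 < q - 1 := by linarith
  have hR : ∫⁻ z in unitDisk, ENNReal.ofReal (‖deriv f z‖ ^ 2 * ‖f z‖ ^ (p - 2)) *
        logSeries q (1 - ‖z‖ ^ 2) = ∫⁻ σ in Ioo (0 : ℝ) 1, c σ * logSeries q (1 - σ ^ 2) := by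
    have hSm := measurable_logSeries q
    rw [setLIntegral_congr_fun (g := fun z => Y z * logSeries q (1 - ‖z‖ ^ 2)) hU
      fun z hz => by simp only [hY, hFe z hz, hF'e z hz],
      lintegral_unitDisk_polar (by fun_prop)]
    refine setLIntegral_congr_fun measurableSet_Ioo fun r hr => ?_
    simp only [norm_real_mul_exp_I, sq_abs, hc]
    rw [lintegral_mul_const _ (show Measurable fun θ : ℝ => Y (r * Complex.exp (θ * Complex.I))
      from hYm.comp (by fun_prop)), mul_assoc]
  have hT : ∀ σ ∈ Ioo (0 : ℝ) 1, c σ * ∫⁻ s in Ioo σ 1,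
      ENNReal.ofReal (p ^ 2 / (2 * (q - 1))) * ENNReal.ofReal (1 / s * (1 - s ^ 2) ^ (q - 1)) =
      ENNReal.ofReal (p ^ 2 / (4 * (q - 1))) * (c σ * logSeries q (1 - σ ^ 2)) := by
    intro σ hσ
    rw [lintegral_const_mul' _ _ ENNReal.ofReal_ne_top, lintegral_inv_mul_rpow hq hσ.1.le hσ.2,
      ← mul_assoc, ← mul_assoc, mul_assoc (c σ), ← ENNReal.ofReal_mul (by positivity), ← mul_assoc,
      mul_comm (c σ)]
    congr 3
    field_simp; norm_num
  rw [hL, hR, lintegral_add_left (by fun_prop), lintegral_mul_const _ hwm,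
    lintegral_radial_weight hq1 le_rfl one_pos, lintegral_triangle_swap hwm hAm,
    setLIntegral_congr_fun measurableSet_Ioo hV, lintegral_triangle_swap (by fun_prop) hcm,
    setLIntegral_congr_fun measurableSet_Ioo hT, lintegral_const_mul' _ _ ENNReal.ofReal_ne_top,
    mul_add, ← mul_assoc, ← mul_assoc, ← ENNReal.ofReal_mul hq1.le, ← ENNReal.ofReal_mul hq1.le,
    ← ENNReal.ofReal_mul (by simp; positivity)]
  congr 2
  · simp; field_simp
  · congr 1
    field_simp

lemma one_sub_norm_sq_pos {z : ℂ} (hz : z ∈ unitDisk) : 0 < 1 - ‖z‖ ^ 2 := by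
  have := mem_unitDisk_iff.1 hz
  nlinarith [norm_nonneg z]

lemma Hinner_eq_tsum {α : ℝ} (hα : -1 ≤ α) {z : ℂ} (hz : z ∈ unitDisk) :
    Hinner α z = ∑' n : ℕ, ENNReal.ofReal ((1 - ‖z‖ ^ 2) ^ n / (n + (α + 2))) := by
  have hρ0 := one_sub_norm_sq_pos hz
  have hρ1 : 1 - ‖z‖ ^ 2 ≤ 1 := by linarith [sq_nonneg ‖z‖]
  set ρ := 1 - ‖z‖ ^ 2
  have h1 : ∀ s ∈ Ioo (0 : ℝ) 1, ENNReal.ofReal (s ^ (α + 1) / (1 - ρ * s)) =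
      ∑' n : ℕ, ENNReal.ofReal (ρ ^ n * s ^ (n + (α + 1))) := by
    intro s hs
    have hs0 := hs.1
    have h0 : 0 ≤ ρ * s := by positivity
    have h2 : ρ * s < 1 := by nlinarith [hs.1, hs.2]
    have h := (hasSum_geometric_of_lt_one h0 h2).mul_left (s ^ (α + 1))
    rw [← div_eq_mul_inv] at h
    rw [← h.tsum_eq, ENNReal.ofReal_tsum_of_nonneg (fun n => by positivity) h.summable]
    congr 1; ext1 n
    rw [Real.rpow_add hs0 n, Real.rpow_natCast, mul_pow]
    congr 1; ring
  rw [Hinner, setLIntegral_congr_fun measurableSet_Ioo h1, lintegral_tsum (fun n => by fun_prop)]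
  congr 1; ext1 n
  have hn : -1 < (n : ℝ) + (α + 1) := by have := n.cast_nonneg (α := ℝ); linarith
  have hint : IntervalIntegrable (fun s : ℝ => ρ ^ n * s ^ (n + (α + 1))) volume 0 1 :=
    (intervalIntegral.intervalIntegrable_rpow' hn).const_mul _
  rw [← ofReal_intervalIntegral_eq_lintegral zero_le_one
    (((intervalIntegrable_iff_integrableOn_Ioc_of_le zero_le_one).1 hint).mono_set
      Ioo_subset_Ioc_self) (fun s hs => by have := hs.1; positivity),
    intervalIntegral.integral_const_mul, integral_rpow (Or.inl hn)]
  congr 1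
  rw [Real.one_rpow, Real.zero_rpow (by linarith), show (n : ℝ) + (α + 1) + 1 = n + (α + 2) by ring]
  ring

lemma inv_le_Hinner {α : ℝ} (hα : -1 ≤ α) {z : ℂ} (hz : z ∈ unitDisk) :
    ENNReal.ofReal (1 / (α + 2)) ≤ Hinner α z := by
  rw [Hinner_eq_tsum hα hz]
  refine le_trans ?_ (ENNReal.le_tsum 0)
  simp

lemma logSeries_eq_add {q ρ : ℝ} :
    logSeries q ρ = ENNReal.ofReal (ρ ^ q / q) + logSeries (q + 1) ρ := by
  rw [logSeries, tsum_eq_zero_add' ENNReal.summable, logSeries]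
  congr 1
  · simp
  · congr 1; ext1 n
    push_cast
    rw [show q + (n + 1 : ℝ) = q + 1 + n by ring]

lemma Hinner_le_logSeries {α p : ℝ} (hα : -1 ≤ α) (hp : 2 < p) {z : ℂ} (hz : z ∈ unitDisk) :
    ENNReal.ofReal (p / 2 * (1 - ‖z‖ ^ 2) ^ (p * (α + 2) / 2)) * Hinner α z ≤
      ENNReal.ofReal (p ^ 2 / 4) * logSeries (p / 2 * (α + 2)) (1 - ‖z‖ ^ 2) := by
  have hρ0 := one_sub_norm_sq_pos hz
  have hα2 : 0 < α + 2 := by linarith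
  rw [Hinner_eq_tsum hα hz, logSeries, ← ENNReal.tsum_mul_left, ← ENNReal.tsum_mul_left]
  refine ENNReal.tsum_le_tsum fun n => ?_
  rw [← ENNReal.ofReal_mul (by positivity), ← ENNReal.ofReal_mul (by positivity)]
  apply ENNReal.ofReal_le_ofReal
  rw [Real.rpow_add hρ0, Real.rpow_natCast, show p * (α + 2) / 2 = p / 2 * (α + 2) by ring]
  set X := (1 - ‖z‖ ^ 2) ^ (p / 2 * (α + 2))
  have hX : 0 ≤ X := by positivity
  have hn := n.cast_nonneg (α := ℝ)
  have hP : 0 ≤ (1 - ‖z‖ ^ 2) ^ n := by positivity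
  have key : 1 / ((n : ℝ) + (α + 2)) ≤ p / 2 / (p / 2 * (α + 2) + n) := by
    rw [div_le_div_iff₀ (by positivity) (by positivity)]
    nlinarith
  calc p / 2 * X * ((1 - ‖z‖ ^ 2) ^ n / (n + (α + 2)))
      = p / 2 * X * (1 - ‖z‖ ^ 2) ^ n * (1 / (n + (α + 2))) := by ring
    _ ≤ p / 2 * X * (1 - ‖z‖ ^ 2) ^ n * (p / 2 / (p / 2 * (α + 2) + n)) := by gcongr
    _ = _ := by ring

lemma ApIntPow_eq {f : ℂ → ℂ} (hf : DifferentiableOn ℂ f unitDisk) {p q : ℝ}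
    (hp : 2 < p) (hq : 1 < q) :
    ApIntPow p (q - 2) f = ENNReal.ofReal (‖f 0‖ ^ p) + (ENNReal.ofReal (p ^ 2 / 4) *
      ∫⁻ z in unitDisk, ENNReal.ofReal (‖deriv f z‖ ^ 2 * ‖f z‖ ^ (p - 2)) *
        logSeries q (1 - ‖z‖ ^ 2)) / ENNReal.ofReal Real.pi := by
  rw [ApIntPow, show q - 2 + 1 = q - 1 by ring, lintegral_norm_rpow_eq hf hp hq,
    ENNReal.add_div, ← ENNReal.ofReal_div_of_pos Real.pi_pos]
  congr 3
  have := Real.pi_pos.ne'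
  field_simp

lemma one_lt_half_mul {α p : ℝ} (hα : -1 ≤ α) (hp : 2 < p) : 1 < p / 2 * (α + 2) := by nlinarith

lemma Ffun_le_ApIntPow {f : ℂ → ℂ} (hf : DifferentiableOn ℂ f unitDisk) {α p : ℝ}
    (hα : -1 ≤ α) (hp : 2 < p) : Ffun α p f ≤ ApIntPow p (p / 2 * (α + 2) - 2) f := by
  rw [ApIntPow_eq hf hp (one_lt_half_mul hα hp), Ffun]
  refine add_le_add_right (ENNReal.div_le_div_right ?_ _) _
  rw [← lintegral_const_mul' _ _ ENNReal.ofReal_ne_top,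
    ← lintegral_const_mul' _ _ ENNReal.ofReal_ne_top]
  refine setLIntegral_mono' isOpen_unitDisk.measurableSet fun z hz => ?_
  have hρ0 := one_sub_norm_sq_pos hz
  have h := Hinner_le_logSeries hα hp hz
  rw [mul_left_comm (ENNReal.ofReal (p ^ 2 / 4)), ← mul_assoc, ← ENNReal.ofReal_mul (by positivity)]
  refine le_trans (le_of_eq ?_) (mul_le_mul_right h _)
  rw [← mul_assoc (ENNReal.ofReal (‖deriv f z‖ ^ 2 * ‖f z‖ ^ (p - 2))),
    ← ENNReal.ofReal_mul (by positivity)]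
  congr 2; ring

lemma Gfun_le_Ffun {f : ℂ → ℂ} {α p : ℝ} (hα : -1 ≤ α) (hp : 2 < p) :
    Gfun α p f ≤ Ffun α p f := by
  rw [Ffun, Gfun]
  refine le_trans (ENNReal.div_le_div_right ?_ _) le_add_self
  rw [← lintegral_const_mul' _ _ ENNReal.ofReal_ne_top,
    ← lintegral_const_mul' _ _ ENNReal.ofReal_ne_top]
  refine setLIntegral_mono' isOpen_unitDisk.measurableSet fun z hz => ?_
  have hα2 : 0 < α + 2 := by linarith
  have h : ENNReal.ofReal (p / (2 * (α + 2))) ≤ ENNReal.ofReal (p / 2) * Hinner α z := by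
    refine le_trans (le_of_eq ?_) (mul_le_mul_right (inv_le_Hinner hα hz) _)
    rw [← ENNReal.ofReal_mul (by positivity)]
    congr 1; field_simp
  rw [mul_left_comm, mul_comm (ENNReal.ofReal (p / (2 * (α + 2))))]
  gcongr

lemma ApIntPow_eq_Gfun_add {f : ℂ → ℂ} (hf : DifferentiableOn ℂ f unitDisk) {α p : ℝ}
    (hα : -1 ≤ α) (hp : 2 < p) : ApIntPow p (p / 2 * (α + 2) - 2) f =
      Gfun α p f + ApIntPow p (p / 2 * (α + 2) - 1) f := by
  have hq := one_lt_half_mul hα hp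
  have hα2 : 0 < α + 2 := by linarith
  rw [show p / 2 * (α + 2) - 1 = p / 2 * (α + 2) + 1 - 2 by ring, ApIntPow_eq hf hp hq,
    ApIntPow_eq hf hp (by linarith), add_left_comm, Gfun, ← ENNReal.add_div]
  congr 2
  have hm : AEMeasurable (fun z => ENNReal.ofReal (‖deriv f z‖ ^ 2 * ‖f z‖ ^ (p - 2)) *
      ENNReal.ofReal ((1 - ‖z‖ ^ 2) ^ (p / 2 * (α + 2)) / (p / 2 * (α + 2))))
      (volume.restrict unitDisk) := by
    have := hf.continuousOn.aemeasurable (μ := volume) isOpen_unitDisk.measurableSet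
    have := measurable_deriv f
    fun_prop
  simp_rw [logSeries_eq_add (q := p / 2 * (α + 2)), mul_add (ENNReal.ofReal (_ * _))]
  rw [lintegral_add_left' hm, mul_add]
  congr 1
  rw [← lintegral_const_mul' _ _ ENNReal.ofReal_ne_top,
    ← lintegral_const_mul' _ _ ENNReal.ofReal_ne_top]
  refine setLIntegral_congr_fun isOpen_unitDisk.measurableSet fun z hz => ?_
  rw [← ENNReal.ofReal_mul (by positivity), ← ENNReal.ofReal_mul (by positivity),
    ← ENNReal.ofReal_mul (by positivity), show p * (α + 2) / 2 = p / 2 * (α + 2) by ring]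
  congr 1
  field_simp; ring

lemma hasFPowerSeriesOnBall_of_hasSum {a : ℕ → ℂ} {f : ℂ → ℂ}
    (h : ∀ z ∈ unitDisk, HasSum (fun n => a n * z ^ n) (f z)) :
    HasFPowerSeriesOnBall f (FormalMultilinearSeries.ofScalars ℂ a) 0 1 where
  r_le := by
    refine ENNReal.le_of_forall_nnreal_lt fun r hr => ?_
    apply FormalMultilinearSeries.le_radius_of_summable
    have hr1 : (r : ℝ) < 1 := by exact_mod_cast hr
    have := (h (r : ℝ) (mem_unitDisk_iff.2 (by simpa using hr1))).summable.norm
    simpa [FormalMultilinearSeries.ofScalars_norm] using this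
  r_pos := one_pos
  hasSum := by
    intro y hy
    have hy1 : y ∈ unitDisk := by
      rw [mem_unitDisk_iff]
      simpa [Metric.mem_eball, edist_zero_right, ← ofReal_norm] using hy
    simpa [FormalMultilinearSeries.ofScalars_apply_eq, mul_comm] using h y hy1

lemma differentiableOn_of_hasSum {a : ℕ → ℂ} {f : ℂ → ℂ}
    (h : ∀ z ∈ unitDisk, HasSum (fun n => a n * z ^ n) (f z)) : DifferentiableOn ℂ f unitDisk := by
  have := (hasFPowerSeriesOnBall_of_hasSum h).differentiableOn
  refine this.mono fun z hz => ?_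
  rw [mem_unitDisk_iff] at hz
  simpa [Metric.mem_eball, edist_zero_right, ← ofReal_norm] using hz

lemma taylorCoeff_of_hasSum {a : ℕ → ℂ} {f : ℂ → ℂ}
    (h : ∀ z ∈ unitDisk, HasSum (fun n => a n * z ^ n) (f z)) (n : ℕ) : taylorCoeff f n = a n := by
  have h1 := (hasFPowerSeriesOnBall_of_hasSum h).hasFPowerSeriesAt
  have h2 := h1.analyticAt.hasFPowerSeriesAt
  exact congrFun (FormalMultilinearSeries.ofScalars_series_injective ℂ ℂ
    (h2.eq_formalMultilinearSeries h1)) n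

lemma hasSum_taylorCoeff {f : ℂ → ℂ} (hf : DifferentiableOn ℂ f unitDisk) {z : ℂ}
    (hz : z ∈ unitDisk) : HasSum (fun n => taylorCoeff f n * z ^ n) (f z) := by
  have := Complex.hasSum_taylorSeries_on_ball hf hz
  refine this.congr_fun fun n => ?_
  simp [taylorCoeff]
  ring

lemma ccoef_pos {b : ℝ} (hb : 0 < b) (n : ℕ) : 0 < ccoef b n := by
  have := Real.Gamma_pos_of_pos hb
  have := Real.Gamma_pos_of_pos (show 0 < n + b by positivity)
  unfold ccoef
  positivity

lemma ofReal_ccoef_eq_choose {b : ℝ} (hb : 0 < b) (n : ℕ) :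
    (ccoef b n : ℂ) = Ring.choose ((b : ℂ) + n - 1) n := by
  rw [← Ring.multichoose_eq]
  have h1 := Ring.factorial_nsmul_multichoose_eq_ascPochhammer (b : ℂ) n
  rw [Polynomial.ascPochhammer_smeval_eq_eval, nsmul_eq_mul, ← Complex.Gamma_add_nat_div_Gamma_eq] at h1
  · have hn : (n.factorial : ℂ) ≠ 0 := by exact_mod_cast n.factorial_ne_zero
    rw [← mul_right_inj' hn, h1, ccoef]
    push_cast
    rw [← Complex.Gamma_ofReal, ← Complex.Gamma_ofReal]
    push_cast
    rw [add_comm (n : ℂ)]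
    field_simp
  · intro k hk
    have := congrArg Complex.re hk
    simp at this
    have hk := k.cast_nonneg (α := ℝ)
    linarith

/-- The reproducing kernel `(1 - w)^(-b)`. -/
def bkernel (b : ℝ) (w : ℂ) : ℂ := Complex.exp (-b * Complex.log (1 - w))

lemma hasSum_bkernel {b : ℝ} (hb : 0 < b) {w : ℂ} (hw : ‖w‖ < 1) :
    HasSum (fun n => (ccoef b n : ℂ) * w ^ n) (bkernel b w) := by
  have h := (Complex.one_div_one_sub_cpow_hasFPowerSeriesOnBall_zero b).hasSum (y := w)
    (by simpa [Metric.mem_eball, edist_zero_right, ← ofReal_norm] using hw)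
  have hne : (1 : ℂ) - w ≠ 0 := by
    intro h0
    rw [sub_eq_zero] at h0
    simp [← h0] at hw
  have he : 1 / (1 - (0 + w)) ^ (b : ℂ) = bkernel b w := by
    rw [zero_add, bkernel, Complex.cpow_def_of_ne_zero hne, one_div, ← Complex.exp_neg]
    congr 1; ring
  rw [he] at h
  simpa [FormalMultilinearSeries.ofScalars_apply_eq, ofReal_ccoef_eq_choose hb, mul_comm] using h

lemma re_one_sub_pos {w : ℂ} (hw : ‖w‖ < 1) : 0 < (1 - w).re := by
  have := Complex.re_le_norm w
  simp; linarith

lemma log_mul_mul_eq {x y z : ℂ} (hx : 0 < x.re) (hy : 0 < y.re) (hz : 0 < z.re)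
    (hxyz : 0 < (x * y * z).re) :
    Complex.log (x * y * z) = Complex.log x + Complex.log y + Complex.log z := by
  have hne : ∀ {u : ℂ}, 0 < u.re → u ≠ 0 := by
    rintro u hu rfl
    simp at hu
  have himb : ∀ {u : ℂ}, 0 < u.re → |(Complex.log u).im| < Real.pi / 2 := by
    intro u hu
    rw [Complex.log_im]
    exact Complex.abs_arg_lt_pi_div_two_iff.2 (Or.inl hu)
  have h1 : Complex.exp (Complex.log (x * y * z)) =
      Complex.exp (Complex.log x + Complex.log y + Complex.log z) := by
    rw [Complex.exp_add, Complex.exp_add, Complex.exp_log (hne hx), Complex.exp_log (hne hy),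
      Complex.exp_log (hne hz), Complex.exp_log (hne hxyz)]
  obtain ⟨n, hn⟩ := Complex.exp_eq_exp_iff_exists_int.1 h1
  have him := congrArg Complex.im hn
  simp only [Complex.add_im, Complex.mul_im, Complex.intCast_re, Complex.intCast_im, Complex.mul_re,
    Complex.ofReal_re, Complex.ofReal_im, Complex.I_re, Complex.I_im, Complex.re_ofNat,
    Complex.im_ofNat] at him
  have a1 := abs_lt.1 (himb hx)
  have a2 := abs_lt.1 (himb hy)
  have a3 := abs_lt.1 (himb hz)
  have a4 := abs_lt.1 (himb hxyz)
  have hpi := Real.pi_pos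
  have hn1 : (n : ℝ) < 1 := by nlinarith
  have hn2 : -1 < (n : ℝ) := by nlinarith
  have hn0 : n = 0 := by
    have h3 : n < 1 := by exact_mod_cast hn1
    have h4 : -1 < n := by exact_mod_cast hn2
    omega
  simpa [hn0] using hn

/-- The Hilbert space of square-summable sequences. -/
abbrev SeqSpace : Type := lp (fun _ : ℕ => ℂ) 2

lemma hasSum_norm_sq_seqSpace (x : SeqSpace) : HasSum (fun n => ‖x n‖ ^ 2) (‖x‖ ^ 2) := by
  simpa using lp.hasSum_norm (p := 2) (by simp) x

lemma ofReal_sqrt_ccoef_sq {b : ℝ} (hb : 0 < b) (n : ℕ) :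
    (√(ccoef b n) : ℂ) * √(ccoef b n) = ccoef b n := by
  rw [← Complex.ofReal_mul, Real.mul_self_sqrt (ccoef_pos hb n).le]

lemma memℓp_kernel {b : ℝ} (hb : 0 < b) {z : ℂ} (hz : z ∈ unitDisk) :
    Memℓp (fun n : ℕ => (√(ccoef b n) : ℂ) * conj z ^ n) 2 := by
  rw [mem_unitDisk_iff] at hz
  have h2 : ‖(z * conj z)‖ < 1 := by
    rw [norm_mul, RCLike.norm_conj]; nlinarith [norm_nonneg z]
  refine memℓp_gen ?_
  refine (hasSum_bkernel hb h2).summable.norm.congr fun n => ?_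
  simp [abs_of_pos (ccoef_pos hb n), mul_pow, Real.sq_sqrt (ccoef_pos hb n).le]
  left; ring

open Classical in
/-- The vector representing evaluation at `z`. -/
def kernelVec (b : ℝ) (z : ℂ) : SeqSpace :=
  if h : Memℓp (fun n : ℕ => (√(ccoef b n) : ℂ) * conj z ^ n) 2 then ⟨_, h⟩ else 0

lemma kernelVec_apply {b : ℝ} (hb : 0 < b) {z : ℂ} (hz : z ∈ unitDisk) (n : ℕ) :
    kernelVec b z n = (√(ccoef b n) : ℂ) * conj z ^ n := by
  rw [kernelVec, dif_pos (memℓp_kernel hb hz)]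

/-- The holomorphic function on the disk represented by a sequence. -/
def evalFun (b : ℝ) (x : SeqSpace) (z : ℂ) : ℂ := inner ℂ (kernelVec b z) x

lemma hasSum_evalFun {b : ℝ} (hb : 0 < b) (x : SeqSpace) {z : ℂ} (hz : z ∈ unitDisk) :
    HasSum (fun n => (√(ccoef b n) : ℂ) * x n * z ^ n) (evalFun b x z) := by
  refine (lp.hasSum_inner (kernelVec b z) x).congr_fun fun n => ?_
  rw [kernelVec_apply hb hz]
  simp
  ring

lemma differentiableOn_evalFun {b : ℝ} (hb : 0 < b) (x : SeqSpace) :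
    DifferentiableOn ℂ (evalFun b x) unitDisk :=
  differentiableOn_of_hasSum fun _ hz => hasSum_evalFun hb x hz

lemma taylorCoeff_evalFun {b : ℝ} (hb : 0 < b) (x : SeqSpace) (n : ℕ) :
    taylorCoeff (evalFun b x) n = √(ccoef b n) * x n :=
  taylorCoeff_of_hasSum (fun _ hz => hasSum_evalFun hb x hz) n

lemma A2normSq_of_taylorCoeff {α : ℝ} (hα : -1 ≤ α) {f : ℂ → ℂ} {x : SeqSpace}
    (h : ∀ n, taylorCoeff f n = √(ccoef (α + 2) n) * x n) :
    A2normSq α f = ENNReal.ofReal (‖x‖ ^ 2) := by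
  have hb : 0 < α + 2 := by linarith
  have hs := hasSum_norm_sq_seqSpace x
  rw [← hs.tsum_eq, ENNReal.ofReal_tsum_of_nonneg (fun n => by positivity) hs.summable, A2normSq]
  congr 1; ext1 n
  have hc := ccoef_pos hb n
  rw [h n, norm_mul, mul_pow, Complex.norm_real, Real.norm_of_nonneg (Real.sqrt_nonneg _),
    Real.sq_sqrt hc.le]
  congr 1
  field_simp

lemma A2norm_evalFun {α : ℝ} (hα : -1 ≤ α) (x : SeqSpace) :
    A2norm α (evalFun (α + 2) x) = ENNReal.ofReal ‖x‖ := by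
  rw [A2norm, A2normSq_of_taylorCoeff hα fun n => taylorCoeff_evalFun (by linarith) x n,
    ENNReal.ofReal_rpow_of_nonneg (by positivity) (by norm_num), ← Real.sqrt_eq_rpow,
    Real.sqrt_sq (norm_nonneg x)]

lemma exists_evalFun_eq {α : ℝ} (hα : -1 ≤ α) {f : ℂ → ℂ} (hf : DifferentiableOn ℂ f unitDisk)
    (hfin : A2norm α f < ⊤) : ∃ x : SeqSpace, ∀ z ∈ unitDisk, f z = evalFun (α + 2) x z := by
  have hb : 0 < α + 2 := by linarith
  have hfin' : A2normSq α f ≠ ⊤ := by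
    intro h
    rw [A2norm, h, ENNReal.top_rpow_of_pos (by norm_num)] at hfin
    exact lt_irrefl _ hfin
  have hmem : Memℓp (fun n : ℕ => taylorCoeff f n / √(ccoef (α + 2) n)) 2 := by
    refine memℓp_gen ?_
    have := ENNReal.summable_toReal hfin'
    refine this.congr fun n => ?_
    have hc := ccoef_pos hb n
    rw [ENNReal.toReal_ofReal (by positivity)]
    simp [div_pow, Real.sq_sqrt hc.le]
  refine ⟨⟨_, hmem⟩, fun z hz => ?_⟩
  refine (hasSum_taylorCoeff hf hz).unique ((hasSum_evalFun hb _ hz).congr_fun fun n => ?_)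
  have hc : (√(ccoef (α + 2) n) : ℂ) ≠ 0 := by
    exact_mod_cast (Real.sqrt_pos.2 (ccoef_pos hb n)).ne'
  simp only
  field_simp

lemma evalFun_kernelVec {b : ℝ} (hb : 0 < b) {a z : ℂ} (ha : a ∈ unitDisk) (hz : z ∈ unitDisk) :
    evalFun b (kernelVec b a) z = bkernel b (z * conj a) := by
  have h : ‖z * conj a‖ < 1 := by
    rw [mem_unitDisk_iff] at ha hz
    rw [norm_mul, RCLike.norm_conj]
    nlinarith [norm_nonneg z, norm_nonneg a]
  refine (hasSum_evalFun hb _ hz).unique ((hasSum_bkernel hb h).congr_fun fun n => ?_)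
  rw [kernelVec_apply hb ha, mul_pow, ← ofReal_sqrt_ccoef_sq hb]
  ring

lemma evalFun_injective {b : ℝ} (hb : 0 < b) {x : SeqSpace}
    (h : ∀ z ∈ unitDisk, evalFun b x z = 0) : x = 0 := by
  ext n
  have h1 := taylorCoeff_evalFun hb x n
  have h2 : taylorCoeff (evalFun b x) n = 0 :=
    taylorCoeff_of_hasSum (a := fun _ => 0) (fun z hz => by simp [h z hz]) n
  rw [h2] at h1
  have hc : (√(ccoef b n) : ℂ) ≠ 0 := by
    exact_mod_cast (Real.sqrt_pos.2 (ccoef_pos hb n)).ne'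
  simpa [hc] using h1.symm

lemma closure_span_kernelVec {b : ℝ} (hb : 0 < b) :
    (Submodule.span ℂ (kernelVec b '' unitDisk)).topologicalClosure = ⊤ := by
  rw [Submodule.topologicalClosure_eq_top_iff, Submodule.eq_bot_iff]
  intro x hx
  refine evalFun_injective hb fun z hz => ?_
  exact (Submodule.mem_orthogonal _ _).1 hx _ (Submodule.subset_span (mem_image_of_mem _ hz))

/-- The involutive disk automorphism `z ↦ (r - z) / (1 - r z)`. -/
def mobius (r : ℝ) (z : ℂ) : ℂ := (r - z) / (1 - r * z)

lemma zero_mem_unitDisk : (0 : ℂ) ∈ unitDisk := by simp [unitDisk]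

lemma norm_ofReal_mul_lt {r : ℝ} (hr : r ∈ Ico (0 : ℝ) 1) {z : ℂ} (hz : z ∈ unitDisk) :
    ‖(r : ℂ) * z‖ < 1 := by
  rw [mem_unitDisk_iff] at hz
  rw [norm_mul, Complex.norm_real, Real.norm_of_nonneg hr.1]
  nlinarith [hr.1, hr.2, norm_nonneg z]

lemma norm_mul_conj_lt {a z : ℂ} (ha : a ∈ unitDisk) (hz : z ∈ unitDisk) : ‖z * conj a‖ < 1 := by
  rw [mem_unitDisk_iff] at ha hz
  rw [norm_mul, RCLike.norm_conj]
  nlinarith [norm_nonneg z, norm_nonneg a]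

lemma one_sub_ne_zero_of_norm_lt {w : ℂ} (hw : ‖w‖ < 1) : 1 - w ≠ 0 := by
  intro h
  have := re_one_sub_pos hw
  simp [h] at this

lemma conj_mem_unitDisk {z : ℂ} (hz : z ∈ unitDisk) : conj z ∈ unitDisk := by
  rw [mem_unitDisk_iff] at hz ⊢
  rwa [RCLike.norm_conj]

lemma one_sub_sq_pos_of_mem_Ico {r : ℝ} (hr : r ∈ Ico (0 : ℝ) 1) : 0 < 1 - r ^ 2 := by
  nlinarith [hr.1, hr.2]

lemma mobius_zero (r : ℝ) : mobius r 0 = r := by simp [mobius]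

lemma one_sub_mobius_mul_conj {r : ℝ} (hr : r ∈ Ico (0 : ℝ) 1) {a c : ℂ} (ha : a ∈ unitDisk)
    (hc : c ∈ unitDisk) :
    (1 - mobius r a * conj (mobius r c)) * (1 - r * a) * (1 - r * conj c) =
      ((1 - r ^ 2 : ℝ) : ℂ) * (1 - a * conj c) := by
  have h1 := one_sub_ne_zero_of_norm_lt (norm_ofReal_mul_lt hr ha)
  have h2 := one_sub_ne_zero_of_norm_lt (norm_ofReal_mul_lt hr (conj_mem_unitDisk hc))
  simp only [mobius, map_div₀, map_sub, map_mul, map_one, Complex.conj_ofReal]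
  field_simp
  push_cast
  ring

lemma one_sub_norm_mobius_sq {r : ℝ} (hr : r ∈ Ico (0 : ℝ) 1) {z : ℂ} (hz : z ∈ unitDisk) :
    1 - ‖mobius r z‖ ^ 2 = (1 - r ^ 2) * (1 - ‖z‖ ^ 2) / ‖1 - r * z‖ ^ 2 := by
  have h1 := one_sub_ne_zero_of_norm_lt (norm_ofReal_mul_lt hr hz)
  have h := one_sub_mobius_mul_conj hr hz hz
  have h2 : (1 - (r : ℂ) * conj z) = conj (1 - r * z) := by simp
  rw [h2, mul_assoc, Complex.mul_conj, Complex.mul_conj, Complex.mul_conj,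
    Complex.normSq_eq_norm_sq, Complex.normSq_eq_norm_sq, Complex.normSq_eq_norm_sq] at h
  rw [eq_div_iff (by positivity)]
  exact_mod_cast h

lemma mobius_mem_unitDisk {r : ℝ} (hr : r ∈ Ico (0 : ℝ) 1) {z : ℂ} (hz : z ∈ unitDisk) :
    mobius r z ∈ unitDisk := by
  have h := one_sub_norm_mobius_sq hr hz
  have h1 := one_sub_ne_zero_of_norm_lt (norm_ofReal_mul_lt hr hz)
  have h2 := one_sub_norm_sq_pos hz
  have h3 := one_sub_sq_pos_of_mem_Ico hr
  have h4 : 0 < 1 - ‖mobius r z‖ ^ 2 := by rw [h]; positivity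
  rw [mem_unitDisk_iff]
  nlinarith [norm_nonneg (mobius r z)]

lemma mobius_mobius {r : ℝ} (hr : r ∈ Ico (0 : ℝ) 1) {z : ℂ} (hz : z ∈ unitDisk) :
    mobius r (mobius r z) = z := by
  have h1 := one_sub_ne_zero_of_norm_lt (norm_ofReal_mul_lt hr hz)
  have h2 := one_sub_ne_zero_of_norm_lt (norm_ofReal_mul_lt hr (mobius_mem_unitDisk hr hz))
  rw [mobius, div_eq_iff h2, mobius]
  field_simp
  ring

lemma log_one_sub_mobius_mul_conj {r : ℝ} (hr : r ∈ Ico (0 : ℝ) 1) {a c : ℂ} (ha : a ∈ unitDisk)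
    (hc : c ∈ unitDisk) :
    Complex.log (1 - mobius r a * conj (mobius r c)) + Complex.log (1 - r * a) +
      Complex.log (1 - r * conj c) = Real.log (1 - r ^ 2) + Complex.log (1 - a * conj c) := by
  have h := one_sub_mobius_mul_conj hr ha hc
  have h3 := one_sub_sq_pos_of_mem_Ico hr
  have h4 := re_one_sub_pos (norm_mul_conj_lt hc ha)
  rw [← log_mul_mul_eq, h, Complex.log_ofReal_mul h3
    (one_sub_ne_zero_of_norm_lt (norm_mul_conj_lt hc ha))]
  · exact re_one_sub_pos (norm_mul_conj_lt (mobius_mem_unitDisk hr hc) (mobius_mem_unitDisk hr ha))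
  · exact re_one_sub_pos (norm_ofReal_mul_lt hr ha)
  · exact re_one_sub_pos (norm_ofReal_mul_lt hr (conj_mem_unitDisk hc))
  · rw [h, Complex.re_ofReal_mul]
    positivity

lemma bkernel_mobius_mul_conj (b : ℝ) {r : ℝ} (hr : r ∈ Ico (0 : ℝ) 1) {a c : ℂ}
    (ha : a ∈ unitDisk) (hc : c ∈ unitDisk) :
    ((1 - r ^ 2) ^ b : ℝ) * bkernel b (r * a) * bkernel b (r * conj c) *
      bkernel b (mobius r a * conj (mobius r c)) = bkernel b (a * conj c) := by
  have h := log_one_sub_mobius_mul_conj hr ha hc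
  have h3 := one_sub_sq_pos_of_mem_Ico hr
  rw [Real.rpow_def_of_pos h3]
  simp only [bkernel]
  push_cast
  rw [← Complex.exp_add, ← Complex.exp_add, ← Complex.exp_add]
  congr 1
  linear_combination (-(b : ℂ)) * h

lemma bkernel_mul_conj_mobius (b : ℝ) {r : ℝ} (hr : r ∈ Ico (0 : ℝ) 1) {a z : ℂ}
    (ha : a ∈ unitDisk) (hz : z ∈ unitDisk) :
    bkernel b (r * conj a) * bkernel b (z * conj (mobius r a)) =
      bkernel b (r * z) * bkernel b (mobius r z * conj a) := by
  have h1 := log_one_sub_mobius_mul_conj hr (mobius_mem_unitDisk hr hz) ha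
  have h2 := log_one_sub_mobius_mul_conj hr hz zero_mem_unitDisk
  rw [mobius_mobius hr hz] at h1
  simp only [mobius_zero, Complex.conj_ofReal, map_zero, mul_zero, sub_zero, Complex.log_one,
    add_zero] at h2
  rw [mul_comm (mobius r z)] at h2
  simp only [bkernel]
  rw [← Complex.exp_add, ← Complex.exp_add]
  congr 1
  linear_combination (-(b : ℂ)) * h1 + b * h2

lemma conj_bkernel (b : ℝ) {w : ℂ} (hw : ‖w‖ < 1) : conj (bkernel b w) = bkernel b (conj w) := by
  have h : (1 - w).arg ≠ Real.pi := by
    have := Complex.abs_arg_lt_pi_div_two_iff.2 (Or.inl (re_one_sub_pos hw))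
    intro h
    rw [h, abs_of_pos Real.pi_pos] at this
    linarith [Real.pi_pos]
  have h2 : (1 : ℂ) - conj w = conj (1 - w) := by simp
  rw [bkernel, bkernel, ← Complex.exp_conj, h2, Complex.log_conj _ h]
  simp

lemma norm_bkernel (b : ℝ) {w : ℂ} (hw : ‖w‖ < 1) : ‖bkernel b w‖ = ‖1 - w‖ ^ (-b) := by
  have h := norm_pos_iff.2 (one_sub_ne_zero_of_norm_lt hw)
  rw [bkernel, Complex.norm_exp, Real.rpow_def_of_pos h]
  simp [Complex.log_re]
  ring

/-- The unitary action of a Möbius involution on the span of the reproducing kernels. -/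
lemma exists_mobius_isometry {b : ℝ} (hb : 0 < b) {r : ℝ} (hr : r ∈ Ico (0 : ℝ) 1) {x : SeqSpace}
    (hx : x ∈ Submodule.span ℂ (kernelVec b '' unitDisk)) :
    ∃ y : SeqSpace, ‖y‖ = ‖x‖ ∧ ∀ z ∈ unitDisk, evalFun b y z =
      ((1 - r ^ 2) ^ (b / 2) : ℝ) * bkernel b (r * z) * evalFun b x (mobius r z) := by
  obtain ⟨n, k, g, rfl⟩ := Submodule.mem_span_set'.1 hx
  have hg : ∀ i, ∃ a ∈ unitDisk, kernelVec b a = g i := fun i => (g i).2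
  choose a ha hag using hg
  simp only [← hag]
  have h3 := one_sub_sq_pos_of_mem_Ico hr
  set t : ℝ := (1 - r ^ 2) ^ (b / 2) with ht
  have htt : t * t = (1 - r ^ 2) ^ b := by rw [ht, ← Real.rpow_add h3]; congr 1; ring
  set d : Fin n → SeqSpace := fun i => (t * bkernel b (r * conj (a i)) : ℂ) •
    kernelVec b (mobius r (a i)) with hd
  have hgram : ∀ i j, inner ℂ (d i) (d j) = inner ℂ (kernelVec b (a i)) (kernelVec b (a j)) := by
    intro i j
    have e1 := evalFun_kernelVec hb (mobius_mem_unitDisk hr (ha j)) (mobius_mem_unitDisk hr (ha i))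
    have e2 := evalFun_kernelVec hb (ha j) (ha i)
    rw [evalFun] at e1 e2
    rw [e2, ← bkernel_mobius_mul_conj b hr (ha i) (ha j), ← htt]
    simp only [hd, inner_smul_left, inner_smul_right, e1]
    rw [map_mul, conj_bkernel b (norm_ofReal_mul_lt hr (conj_mem_unitDisk (ha i)))]
    simp only [map_mul, Complex.conj_ofReal, Complex.conj_conj]
    push_cast
    ring
  refine ⟨∑ i, k i • d i, ?_, fun z hz => ?_⟩
  · rw [← sq_eq_sq₀ (norm_nonneg _) (norm_nonneg _), @norm_sq_eq_re_inner ℂ,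
      @norm_sq_eq_re_inner ℂ]
    congr 1
    simp only [sum_inner, inner_sum, inner_smul_left, inner_smul_right, hgram]
  · simp only [evalFun, inner_sum, inner_smul_right, Finset.mul_sum, hd]
    refine Finset.sum_congr rfl fun i _ => ?_
    have e1 := evalFun_kernelVec hb (mobius_mem_unitDisk hr (ha i)) hz
    have e2 := evalFun_kernelVec hb (ha i) (mobius_mem_unitDisk hr hz)
    rw [evalFun] at e1 e2
    rw [e1, e2]
    linear_combination (k i * t) * bkernel_mul_conj_mobius b hr (ha i) hz

lemma hasDerivAt_mobius {r : ℝ} (hr : r ∈ Ico (0 : ℝ) 1) {z : ℂ} (hz : z ∈ unitDisk) :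
    HasDerivAt (mobius r) (-((1 - r ^ 2 : ℝ) : ℂ) / (1 - r * z) ^ 2) z := by
  have h1 := one_sub_ne_zero_of_norm_lt (norm_ofReal_mul_lt hr hz)
  have h2 := (((hasDerivAt_id z).const_sub (r : ℂ)).div
    (((hasDerivAt_id z).const_mul (r : ℂ)).const_sub 1) h1)
  refine h2.congr_deriv ?_
  simp only [id]
  congr 1
  push_cast
  ring

lemma injOn_mobius {r : ℝ} (hr : r ∈ Ico (0 : ℝ) 1) : InjOn (mobius r) unitDisk :=
  fun z hz w hw h => by rw [← mobius_mobius hr hz, h, mobius_mobius hr hw]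

lemma image_mobius {r : ℝ} (hr : r ∈ Ico (0 : ℝ) 1) : mobius r '' unitDisk = unitDisk := by
  refine Subset.antisymm (image_subset_iff.2 fun z hz => mobius_mem_unitDisk hr hz) fun z hz => ?_
  exact ⟨_, mobius_mem_unitDisk hr hz, mobius_mobius hr hz⟩

lemma lintegral_comp_mobius {r : ℝ} (hr : r ∈ Ico (0 : ℝ) 1) (h : ℂ → ℝ≥0∞) :
    ∫⁻ z in unitDisk, h z = ∫⁻ z in unitDisk,
      ENNReal.ofReal (((1 - r ^ 2) / ‖1 - r * z‖ ^ 2) ^ 2) * h (mobius r z) := by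
  conv_lhs => rw [← image_mobius hr]
  rw [lintegral_image_eq_lintegral_abs_det_fderiv_mul volume isOpen_unitDisk.measurableSet
    (fun z hz => ((hasDerivAt_mobius hr hz).hasFDerivAt.restrictScalars ℝ).hasFDerivWithinAt)
    (injOn_mobius hr)]
  refine setLIntegral_congr_fun isOpen_unitDisk.measurableSet fun z hz => ?_
  congr 2
  have hd (c : ℂ) : (ContinuousLinearMap.restrictScalars ℝ
      (ContinuousLinearMap.toSpanSingleton ℂ c)).det = ‖c‖ ^ 2 := by
    simp [ContinuousLinearMap.det, LinearMap.det_restrictScalars, Algebra.norm_complex_eq,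
      Complex.normSq_eq_norm_sq]
  rw [hd, abs_of_nonneg (by positivity), norm_div, norm_neg, Complex.norm_real, norm_pow,
    Real.norm_of_nonneg (one_sub_sq_pos_of_mem_Ico hr).le]

lemma one_sub_mul_mobius {r : ℝ} (hr : r ∈ Ico (0 : ℝ) 1) {z : ℂ} (hz : z ∈ unitDisk) :
    1 - r * mobius r z = ((1 - r ^ 2 : ℝ) : ℂ) / (1 - r * z) := by
  have h1 := one_sub_ne_zero_of_norm_lt (norm_ofReal_mul_lt hr hz)
  rw [mobius]
  field_simp
  push_cast
  ring

lemma rpow_weight_cancel {a d ρ F b p : ℝ} (ha : 0 < a) (hd : 0 < d) (hρ : 0 < ρ) (hF : 0 ≤ F) :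
    (a / d ^ 2) ^ 2 * ((a * ρ / d ^ 2) ^ (p / 2 * b - 2) *
      (a ^ (b / 2) * (a / d) ^ (-b) * F) ^ p) = ρ ^ (p / 2 * b - 2) * F ^ p := by
  have h1 : a ^ (b / 2) * (a / d) ^ (-b) = (a / d ^ 2) ^ (-(b / 2)) := by
    rw [Real.rpow_def_of_pos ha, Real.rpow_def_of_pos (by positivity),
      Real.rpow_def_of_pos (by positivity), Real.log_div ha.ne' hd.ne',
      Real.log_div ha.ne' (by positivity), Real.log_pow, ← Real.exp_add]
    congr 1
    push_cast
    ring
  have hK : 0 < a / d ^ 2 := by positivity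
  rw [h1, show a * ρ / d ^ 2 = a / d ^ 2 * ρ by ring]
  generalize a / d ^ 2 = K at hK
  rw [Real.mul_rpow hK.le hρ.le, Real.mul_rpow (by positivity) hF, ← Real.rpow_mul hK.le,
    show K ^ 2 * (K ^ (p / 2 * b - 2) * ρ ^ (p / 2 * b - 2) * (K ^ (-(b / 2) * p) * F ^ p)) =
      K ^ (2 : ℝ) * K ^ (p / 2 * b - 2) * K ^ (-(b / 2) * p) * (ρ ^ (p / 2 * b - 2) * F ^ p) by
      rw [Real.rpow_two]; ring,
    ← Real.rpow_add hK, ← Real.rpow_add hK]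
  rw [show 2 + (p / 2 * b - 2) + -(b / 2) * p = 0 by ring, Real.rpow_zero, one_mul]

lemma lintegral_mobius_weight {b p r : ℝ} (hr : r ∈ Ico (0 : ℝ) 1) {F H : ℂ → ℂ}
    (hH : ∀ z ∈ unitDisk,
      H z = ((1 - r ^ 2) ^ (b / 2) : ℝ) * bkernel b (r * z) * F (mobius r z)) (m : ℂ → ℝ≥0∞) :
    ∫⁻ z in unitDisk, m z * ENNReal.ofReal ((1 - ‖z‖ ^ 2) ^ (p / 2 * b - 2) * ‖H z‖ ^ p) =
      ∫⁻ z in unitDisk, m (mobius r z) *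
        ENNReal.ofReal ((1 - ‖z‖ ^ 2) ^ (p / 2 * b - 2) * ‖F z‖ ^ p) := by
  rw [lintegral_comp_mobius hr]
  refine setLIntegral_congr_fun isOpen_unitDisk.measurableSet fun z hz => ?_
  have h1 := one_sub_ne_zero_of_norm_lt (norm_ofReal_mul_lt hr hz)
  have ha := one_sub_sq_pos_of_mem_Ico hr
  have hφ := mobius_mem_unitDisk hr hz
  rw [mul_left_comm, ← ENNReal.ofReal_mul (by positivity), hH _ hφ, mobius_mobius hr hz,
    one_sub_norm_mobius_sq hr hz, norm_mul, norm_mul, norm_bkernel b (norm_ofReal_mul_lt hr hφ),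
    one_sub_mul_mobius hr hz, norm_div, Complex.norm_real, Complex.norm_real,
    Real.norm_of_nonneg ha.le, Real.norm_of_nonneg (by positivity),
    rpow_weight_cancel ha (by positivity) (one_sub_norm_sq_pos hz) (norm_nonneg _)]

/-- The normalized weighted area measure of the Bergman space `A^p_β`. -/
def bergmanMeasure (β : ℝ) : Measure ℂ :=
  (ENNReal.ofReal (β + 1) / ENNReal.ofReal Real.pi) •
    (volume.restrict unitDisk).withDensity fun z => ENNReal.ofReal ((1 - ‖z‖ ^ 2) ^ β)

lemma lintegral_bergmanMeasure (β : ℝ) {h : ℂ → ℝ≥0∞}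
    (hh : AEMeasurable h (volume.restrict unitDisk)) :
    ∫⁻ z, h z ∂bergmanMeasure β = ENNReal.ofReal (β + 1) *
      (∫⁻ z in unitDisk, ENNReal.ofReal ((1 - ‖z‖ ^ 2) ^ β) * h z) / ENNReal.ofReal Real.pi := by
  rw [bergmanMeasure, lintegral_smul_measure, lintegral_withDensity_eq_lintegral_mul₀
    (by fun_prop) hh, smul_eq_mul, ENNReal.mul_div_right_comm]
  rfl

lemma ae_bergmanMeasure {β : ℝ} {P : ℂ → Prop} (h : ∀ z ∈ unitDisk, P z) :
    ∀ᵐ z ∂bergmanMeasure β, P z := by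
  refine Measure.ae_smul_measure ?_ _
  refine (withDensity_absolutelyContinuous _ _).ae_le ?_
  exact (ae_restrict_iff' isOpen_unitDisk.measurableSet).2 (Eventually.of_forall h)

lemma aestronglyMeasurable_bergmanMeasure {f : ℂ → ℂ} (hf : DifferentiableOn ℂ f unitDisk)
    (β : ℝ) : AEStronglyMeasurable f (bergmanMeasure β) := by
  refine AEStronglyMeasurable.smul_measure ?_ _
  exact (hf.continuousOn.aestronglyMeasurable isOpen_unitDisk.measurableSet).mono_ac
    (withDensity_absolutelyContinuous _ _)

lemma ApNorm_eq_eLpNorm {f : ℂ → ℂ} (hf : DifferentiableOn ℂ f unitDisk) {p : ℝ} (hp : 0 < p)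
    (β : ℝ) : ApNorm p β f = eLpNorm f (ENNReal.ofReal p) (bergmanMeasure β) := by
  have hm := hf.continuousOn.aemeasurable (μ := volume) isOpen_unitDisk.measurableSet
  rw [eLpNorm_eq_lintegral_rpow_enorm_toReal (by simpa using hp) ENNReal.ofReal_ne_top,
    ENNReal.toReal_ofReal hp.le, lintegral_bergmanMeasure β (by fun_prop), ApNorm, ApIntPow]
  congr 3
  refine setLIntegral_congr_fun isOpen_unitDisk.measurableSet fun z hz => ?_
  have hρ := one_sub_norm_sq_pos hz
  rw [ENNReal.ofReal_mul (by positivity), ← ENNReal.ofReal_rpow_of_nonneg (norm_nonneg _) hp.le,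
    ofReal_norm]

lemma lintegral_unitDisk_weight {β : ℝ} (hβ : -1 < β) :
    ∫⁻ z in unitDisk, ENNReal.ofReal ((1 - ‖z‖ ^ 2) ^ β) =
      ENNReal.ofReal (Real.pi / (β + 1)) := by
  have hβ1 : 0 < β + 1 := by linarith
  rw [lintegral_unitDisk_polar (by fun_prop)]
  have h : ∀ r ∈ Ioo (0 : ℝ) 1, ENNReal.ofReal r * ∫⁻ θ in Ioo (-Real.pi) Real.pi,
      ENNReal.ofReal ((1 - ‖(r : ℂ) * Complex.exp (θ * Complex.I)‖ ^ 2) ^ β) =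
      ENNReal.ofReal (2 * Real.pi) * ENNReal.ofReal (r * (1 - r ^ 2) ^ (β + 1 - 1)) := by
    intro r hr
    have hr2 : 0 < 1 - r ^ 2 := by nlinarith [hr.1, hr.2]
    simp only [norm_mul, Complex.norm_real, Complex.norm_exp_ofReal_mul_I, mul_one,
      Real.norm_of_nonneg hr.1.le, lintegral_const, Measure.restrict_apply_univ, Real.volume_Ioo]
    rw [add_sub_cancel_right, ENNReal.ofReal_mul hr.1.le,
      show Real.pi - -Real.pi = 2 * Real.pi by ring]
    ring
  rw [setLIntegral_congr_fun measurableSet_Ioo h, lintegral_const_mul' _ _ ENNReal.ofReal_ne_top,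
    lintegral_radial_weight hβ1 le_rfl zero_lt_one, ← ENNReal.ofReal_mul (by positivity)]
  congr 1
  norm_num
  field_simp

lemma bergmanMeasure_univ {β : ℝ} (hβ : -1 < β) : bergmanMeasure β univ = 1 := by
  have hβ1 : 0 < β + 1 := by linarith
  have h := lintegral_bergmanMeasure β (h := fun _ => 1) aemeasurable_const
  simp only [lintegral_const, one_mul, mul_one] at h
  rw [h, lintegral_unitDisk_weight hβ, ← ENNReal.ofReal_mul hβ1.le,
    ← ENNReal.ofReal_div_of_pos Real.pi_pos]
  simp only [ENNReal.ofReal_eq_one]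
  field_simp

lemma exists_norm_evalFun_le {b : ℝ} (hb : 0 < b) {x : SeqSpace}
    (hx : x ∈ Submodule.span ℂ (kernelVec b '' unitDisk)) :
    ∃ B, 0 ≤ B ∧ ∀ z ∈ unitDisk, ‖evalFun b x z‖ ≤ B := by
  induction hx using Submodule.span_induction with
  | mem x hx =>
    obtain ⟨a, ha, rfl⟩ := hx
    have ha' := mem_unitDisk_iff.1 ha
    refine ⟨(1 - ‖a‖) ^ (-b), by have := sub_pos.2 ha'; positivity, fun z hz => ?_⟩
    have h := norm_mul_conj_lt ha hz
    rw [evalFun_kernelVec hb ha hz, norm_bkernel b h]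
    refine Real.rpow_le_rpow_of_nonpos (by linarith) ?_ (by linarith)
    have h1 := norm_sub_norm_le (1 : ℂ) (z * conj a)
    rw [norm_one, norm_mul, RCLike.norm_conj] at h1
    nlinarith [mem_unitDisk_iff.1 hz, norm_nonneg a]
  | zero => exact ⟨0, le_rfl, fun z _ => by simp [evalFun]⟩
  | add x y _ _ hx hy =>
    obtain ⟨B, hB0, hB⟩ := hx
    obtain ⟨D, hD0, hD⟩ := hy
    refine ⟨B + D, by positivity, fun z hz => ?_⟩
    rw [evalFun, inner_add_right]
    exact (norm_add_le _ _).trans (add_le_add (hB z hz) (hD z hz))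
  | smul c x _ hx =>
    obtain ⟨B, hB0, hB⟩ := hx
    refine ⟨‖c‖ * B, by positivity, fun z hz => ?_⟩
    rw [evalFun, inner_smul_right, norm_mul]
    exact mul_le_mul_of_nonneg_left (hB z hz) (norm_nonneg c)

lemma lintegral_weight_mul_norm_rpow_ne_top {β p B : ℝ} (hβ : -1 < β) (hp : 0 < p) {F : ℂ → ℂ}
    (hB : ∀ z ∈ unitDisk, ‖F z‖ ≤ B) :
    ∫⁻ z in unitDisk, ENNReal.ofReal ((1 - ‖z‖ ^ 2) ^ β * ‖F z‖ ^ p) ≠ ⊤ := by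
  refine ne_top_of_le_ne_top (b := ∫⁻ z in unitDisk,
    ENNReal.ofReal ((1 - ‖z‖ ^ 2) ^ β) * ENNReal.ofReal (B ^ p)) ?_ ?_
  · rw [lintegral_mul_const' _ _ ENNReal.ofReal_ne_top, lintegral_unitDisk_weight hβ]
    exact ENNReal.mul_ne_top ENNReal.ofReal_ne_top ENNReal.ofReal_ne_top
  · refine setLIntegral_mono' isOpen_unitDisk.measurableSet fun z hz => ?_
    have hρ := one_sub_norm_sq_pos hz
    rw [← ENNReal.ofReal_mul (by positivity)]
    gcongr
    exact hB z hz

/-- A sequence in `[0, 1)` converging to `1`. -/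
def radiusSeq (n : ℕ) : ℝ := 1 - 1 / (n + 2)

lemma radiusSeq_mem (n : ℕ) : radiusSeq n ∈ Ico (0 : ℝ) 1 := by
  have h : 1 / ((n : ℝ) + 2) ≤ 1 := by
    rw [div_le_one (by positivity)]
    linarith [(Nat.cast_nonneg n : (0 : ℝ) ≤ n)]
  have h2 : 0 < 1 / ((n : ℝ) + 2) := by positivity
  constructor <;> simp only [radiusSeq] <;> linarith

lemma tendsto_radiusSeq : Tendsto radiusSeq atTop (𝓝 1) := by
  have h : Tendsto (fun n : ℕ => 1 / ((n : ℝ) + 2)) atTop (𝓝 0) :=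
    tendsto_const_nhds.div_atTop (tendsto_natCast_atTop_atTop.atTop_add tendsto_const_nhds)
  have h1 := h.const_sub (1 : ℝ)
  rwa [sub_zero] at h1

lemma tendsto_one_sub_radiusSeq_sq : Tendsto (fun n => 1 - radiusSeq n ^ 2) atTop (𝓝 0) := by
  simpa using (tendsto_radiusSeq.pow 2).const_sub (1 : ℝ)

lemma tendsto_one_sub_norm_mobius_sq {z : ℂ} (hz : z ∈ unitDisk) :
    Tendsto (fun n => 1 - ‖mobius (radiusSeq n) z‖ ^ 2) atTop (𝓝 0) := by
  have h1 : (1 : ℂ) - ((1 : ℝ) : ℂ) * z ≠ 0 := by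
    rw [Complex.ofReal_one, one_mul]
    exact one_sub_ne_zero_of_norm_lt (mem_unitDisk_iff.1 hz)
  have h2 : Tendsto (fun n => ‖1 - (radiusSeq n : ℂ) * z‖ ^ 2) atTop
      (𝓝 (‖1 - ((1 : ℝ) : ℂ) * z‖ ^ 2)) :=
    (((((Complex.continuous_ofReal.tendsto _).comp tendsto_radiusSeq).mul_const z).const_sub
      1).norm).pow 2
  have h3 := (tendsto_one_sub_radiusSeq_sq.mul_const (1 - ‖z‖ ^ 2)).div h2 (by positivity)
  rw [zero_mul, zero_div] at h3
  exact h3.congr fun n => (one_sub_norm_mobius_sq (radiusSeq_mem n) hz).symm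

lemma tendsto_lintegral_mobius_weight {β p B : ℝ} (hβ : -1 < β) (hp : 0 < p) {F : ℂ → ℂ}
    (hF : DifferentiableOn ℂ F unitDisk) (hB : ∀ z ∈ unitDisk, ‖F z‖ ≤ B) :
    Tendsto (fun n => ∫⁻ z in unitDisk, ENNReal.ofReal (1 - ‖mobius (radiusSeq n) z‖ ^ 2) *
      ENNReal.ofReal ((1 - ‖z‖ ^ 2) ^ β * ‖F z‖ ^ p)) atTop (𝓝 0) := by
  have hm := hF.continuousOn.aemeasurable (μ := volume) isOpen_unitDisk.measurableSet
  have hmob (r : ℝ) : Measurable (mobius r) := by unfold mobius; fun_prop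
  have h := tendsto_lintegral_of_dominated_convergence' (μ := volume.restrict unitDisk)
    (F := fun n z => ENNReal.ofReal (1 - ‖mobius (radiusSeq n) z‖ ^ 2) *
      ENNReal.ofReal ((1 - ‖z‖ ^ 2) ^ β * ‖F z‖ ^ p)) (f := fun _ => 0)
    (fun z => ENNReal.ofReal ((1 - ‖z‖ ^ 2) ^ β * ‖F z‖ ^ p)) ?_ ?_
    (lintegral_weight_mul_norm_rpow_ne_top hβ hp hB) ?_
  · simpa using h
  · intro n
    have := hmob (radiusSeq n)
    fun_prop
  · refine fun n => Eventually.of_forall fun z => mul_le_of_le_one_left (zero_le) ?_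
    rw [ENNReal.ofReal_le_one]
    linarith [sq_nonneg ‖mobius (radiusSeq n) z‖]
  · refine (ae_restrict_iff' isOpen_unitDisk.measurableSet).2 (Eventually.of_forall fun z hz => ?_)
    have h1 := ENNReal.tendsto_ofReal (tendsto_one_sub_norm_mobius_sq hz)
    have h2 := ENNReal.Tendsto.mul_const h1 (Or.inr (ENNReal.ofReal_ne_top
      (r := (1 - ‖z‖ ^ 2) ^ β * ‖F z‖ ^ p)))
    simpa using h2

lemma Gfun_const_mul {α p : ℝ} {c : ℝ} (hc : 0 < c) (f : ℂ → ℂ) :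
    Gfun α p (fun z => c * f z) = ENNReal.ofReal (c ^ p) * Gfun α p f := by
  rw [Gfun, Gfun, mul_comm (ENNReal.ofReal (c ^ p)), ← ENNReal.mul_div_right_comm, mul_assoc,
    ← lintegral_mul_const' _ _ ENNReal.ofReal_ne_top]
  congr 4 with z
  rw [mul_comm (ENNReal.ofReal _), ← ENNReal.ofReal_mul (by positivity), deriv_const_mul_field,
    norm_mul, norm_mul, Complex.norm_real, Real.norm_of_nonneg hc.le,
    Real.mul_rpow hc.le (norm_nonneg _)]
  congr 1
  have h : c ^ p = c ^ 2 * c ^ (p - 2) := by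
    rw [← Real.rpow_two, ← Real.rpow_add hc]
    congr 1; ring
  rw [h]
  ring

lemma exists_truncation {b : ℝ} (hb : 0 < b) (x : SeqSpace) (M : ℕ) :
    ∃ y : SeqSpace, ‖y‖ ≤ ‖x‖ ∧ (∀ j ≤ M, y j = 0) ∧ ∀ z ∈ unitDisk,
      ‖evalFun b x z - evalFun b y z‖ ≤
        ∑ j ∈ Finset.range (M + 1), ‖taylorCoeff (evalFun b x) j‖ := by
  have hxs := hasSum_norm_sq_seqSpace x
  have hmem : Memℓp (fun n : ℕ => if n ≤ M then 0 else x n) 2 := by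
    refine memℓp_gen (hxs.summable.of_nonneg_of_le (fun n => by positivity) fun n => ?_)
    split_ifs <;> simp
  set y : SeqSpace := ⟨_, hmem⟩ with hy
  have hyn (n : ℕ) : y n = if n ≤ M then 0 else x n := rfl
  refine ⟨y, ?_, fun j hj => by simp [hyn, hj], fun z hz => ?_⟩
  · have hys := hasSum_norm_sq_seqSpace y
    refine le_of_sq_le_sq (hasSum_le (fun n => ?_) hys hxs) (norm_nonneg _)
    rw [hyn]
    split_ifs <;> simp
  · have h1 := (hasSum_evalFun hb x hz).sub (hasSum_evalFun hb y hz)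
    have h2 := h1.unique (hasSum_sum_of_ne_finset_zero (s := Finset.range (M + 1)) fun n hn => ?_)
    · rw [h2]
      refine (norm_sum_le _ _).trans (Finset.sum_le_sum fun j hj => ?_)
      have hj' : j ≤ M := by simpa [Nat.lt_succ_iff] using hj
      rw [taylorCoeff_evalFun hb, hyn, if_pos hj', mul_zero, zero_mul, sub_zero, norm_mul, norm_pow]
      exact mul_le_of_le_one_right (norm_nonneg _)
        (pow_le_one₀ (norm_nonneg _) (mem_unitDisk_iff.1 hz).le)
    · have hn' : ¬ n ≤ M := by simpa [Nat.lt_succ_iff] using hn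
      rw [hyn, if_neg hn', sub_self]

lemma norm_taylorCoeff_le {f : ℂ → ℂ} (hf : DifferentiableOn ℂ f unitDisk) {B : ℝ}
    (hB : ∀ z, ‖z‖ = 1 / 2 → ‖f z‖ ≤ B) (n : ℕ) : ‖taylorCoeff f n‖ ≤ B * 2 ^ n := by
  have hd : DiffContOnCl ℂ f (Metric.ball 0 (1 / 2)) := by
    refine DifferentiableOn.diffContOnCl_ball (hf.mono fun z hz => ?_) le_rfl
    rw [mem_unitDisk_iff]
    rw [mem_closedBall_zero_iff] at hz
    linarith
  have h := Complex.norm_iteratedDeriv_le_of_forall_mem_sphere_norm_le n (by norm_num) hd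
    fun z hz => hB z (by simpa using hz)
  rw [taylorCoeff, norm_div, Complex.norm_natCast, div_le_iff₀ (by positivity)]
  refine h.trans (le_of_eq ?_)
  rw [div_pow, one_pow, div_div_eq_mul_div, div_one]
  ring

lemma norm_taylorCoeff_le_of_mobius {b : ℝ} (hb : 0 < b) {r : ℝ} (hr : r ∈ Ico (0 : ℝ) 1)
    {F H : ℂ → ℂ} (hHd : DifferentiableOn ℂ H unitDisk) {B : ℝ} (hB : ∀ z ∈ unitDisk, ‖F z‖ ≤ B)
    (hH : ∀ z ∈ unitDisk,
      H z = ((1 - r ^ 2) ^ (b / 2) : ℝ) * bkernel b (r * z) * F (mobius r z)) (n : ℕ) :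
    ‖taylorCoeff H n‖ ≤ (1 - r ^ 2) ^ (b / 2) * ((1 / 2) ^ (-b) * B * 2 ^ n) := by
  have ha := one_sub_sq_pos_of_mem_Ico hr
  refine (norm_taylorCoeff_le (B := (1 - r ^ 2) ^ (b / 2) * ((1 / 2) ^ (-b) * B)) hHd
    (fun z hz => ?_) n).trans (le_of_eq (by ring))
  have hzd : z ∈ unitDisk := by rw [mem_unitDisk_iff, hz]; norm_num
  rw [hH z hzd, norm_mul, norm_mul, Complex.norm_real, Real.norm_of_nonneg (by positivity),
    norm_bkernel b (norm_ofReal_mul_lt hr hzd), mul_assoc]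
  have h1 : 1 / 2 ≤ ‖1 - (r : ℂ) * z‖ := by
    have h := norm_sub_norm_le (1 : ℂ) (r * z)
    rw [norm_one, norm_mul, Complex.norm_real, Real.norm_of_nonneg hr.1, hz] at h
    linarith [hr.2]
  exact mul_le_mul_of_nonneg_left (mul_le_mul
    (Real.rpow_le_rpow_of_nonpos (by norm_num) h1 (by linarith))
    (hB _ (mobius_mem_unitDisk hr hzd)) (norm_nonneg _) (by positivity)) (by positivity)

lemma Gfun_evalFun_le_of_vanishing {α p C : ℝ} (hα : -1 ≤ α) (hC : 0 ≤ C) {M : ℕ}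
    (hM : ∀ f : ℂ → ℂ, DifferentiableOn ℂ f unitDisk → A2norm α f = 1 →
      (∀ j ≤ M, iteratedDeriv j f 0 = 0) → Gfun α p f ≤ ENNReal.ofReal (C ^ p))
    {y : SeqSpace} (hy : ∀ j ≤ M, y j = 0) :
    Gfun α p (evalFun (α + 2) y) ≤ ENNReal.ofReal ((C * ‖y‖) ^ p) := by
  have hb : 0 < α + 2 := by linarith
  rcases eq_or_ne y 0 with rfl | hy0
  · have h : evalFun (α + 2) (0 : SeqSpace) = fun _ => 0 := by ext z; simp [evalFun]
    rw [h, Gfun]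
    simp
  have hN : 0 < ‖y‖ := norm_pos_iff.2 hy0
  have hev : evalFun (α + 2) y =
      fun z => ((‖y‖ : ℝ) : ℂ) * evalFun (α + 2) ((‖y‖⁻¹ : ℂ) • y) z := by
    ext z
    have : (‖y‖ : ℂ) ≠ 0 := by exact_mod_cast hN.ne'
    rw [evalFun, evalFun, inner_smul_right]
    field_simp
  rw [hev, Gfun_const_mul hN, Real.mul_rpow hC hN.le, mul_comm (C ^ p),
    ENNReal.ofReal_mul (by positivity)]
  gcongr
  refine hM _ (differentiableOn_evalFun hb _) ?_ fun j hj => ?_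
  · rw [A2norm_evalFun hα, norm_smul, norm_inv, Complex.norm_real, norm_norm,
      inv_mul_cancel₀ hN.ne', ENNReal.ofReal_one]
  · have h := taylorCoeff_evalFun hb ((‖y‖⁻¹ : ℂ) • y) j
    rw [lp.coeFn_smul, Pi.smul_apply, hy j hj, smul_zero, mul_zero, taylorCoeff,
      div_eq_zero_iff] at h
    exact h.resolve_right (by exact_mod_cast j.factorial_ne_zero)

lemma ApNorm_le_add {f g : ℂ → ℂ} (hf : DifferentiableOn ℂ f unitDisk)
    (hg : DifferentiableOn ℂ g unitDisk) {p β ε : ℝ} (hp : 1 ≤ p) (hβ : -1 < β)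
    (hε : ∀ z ∈ unitDisk, ‖f z - g z‖ ≤ ε) :
    ApNorm p β f ≤ ApNorm p β g + ENNReal.ofReal ε := by
  have hp0 : 0 < p := by linarith
  rw [ApNorm_eq_eLpNorm hf hp0, ApNorm_eq_eLpNorm hg hp0]
  have h1 := eLpNorm_add_le (aestronglyMeasurable_bergmanMeasure hg β)
    (aestronglyMeasurable_bergmanMeasure (hf.sub hg) β) (ENNReal.one_le_ofReal.2 hp)
  have h2 : g + (f - g) = f := by abel
  rw [h2] at h1
  refine h1.trans (add_le_add_right ?_ _)
  have h3 := eLpNorm_le_of_ae_bound (p := ENNReal.ofReal p)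
    (ae_bergmanMeasure (β := β) (P := fun z => ‖(f - g) z‖ ≤ ε) hε)
  rwa [bergmanMeasure_univ hβ, ENNReal.one_rpow, one_mul] at h3

lemma ApIntPow_mobius {b p r : ℝ} (hr : r ∈ Ico (0 : ℝ) 1) {F H : ℂ → ℂ}
    (hH : ∀ z ∈ unitDisk,
      H z = ((1 - r ^ 2) ^ (b / 2) : ℝ) * bkernel b (r * z) * F (mobius r z)) :
    ApIntPow p (p / 2 * b - 2) H = ApIntPow p (p / 2 * b - 2) F := by
  have h := lintegral_mobius_weight (p := p) hr hH fun _ => 1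
  simp only [one_mul] at h
  rw [ApIntPow, ApIntPow, h]

lemma ApIntPow_mobius_succ {b p r : ℝ} (hr : r ∈ Ico (0 : ℝ) 1) {F H : ℂ → ℂ}
    (hH : ∀ z ∈ unitDisk,
      H z = ((1 - r ^ 2) ^ (b / 2) : ℝ) * bkernel b (r * z) * F (mobius r z)) :
    ApIntPow p (p / 2 * b - 1) H = ENNReal.ofReal (p / 2 * b - 1 + 1) *
      (∫⁻ z in unitDisk, ENNReal.ofReal (1 - ‖mobius r z‖ ^ 2) *
        ENNReal.ofReal ((1 - ‖z‖ ^ 2) ^ (p / 2 * b - 2) * ‖F z‖ ^ p)) / ENNReal.ofReal Real.pi := by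
  rw [ApIntPow, ← lintegral_mobius_weight hr hH fun z => ENNReal.ofReal (1 - ‖z‖ ^ 2)]
  congr 2
  refine setLIntegral_congr_fun isOpen_unitDisk.measurableSet fun z hz => ?_
  have hρ := one_sub_norm_sq_pos hz
  rw [← ENNReal.ofReal_mul hρ.le, ← mul_assoc,
    show p / 2 * b - 1 = 1 + (p / 2 * b - 2) by ring, Real.rpow_add hρ, Real.rpow_one]

lemma ApNorm_evalFun_le_of_truncation {α p C : ℝ} (hα : -1 ≤ α) (hp : 2 < p) (hC : 0 ≤ C) {M : ℕ}
    (hM : ∀ f : ℂ → ℂ, DifferentiableOn ℂ f unitDisk → A2norm α f = 1 →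
      (∀ j ≤ M, iteratedDeriv j f 0 = 0) → Gfun α p f ≤ ENNReal.ofReal (C ^ p))
    (x : SeqSpace) {ε : ℝ}
    (hε : ∑ j ∈ Finset.range (M + 1), ‖taylorCoeff (evalFun (α + 2) x) j‖ ≤ ε) :
    ApNorm p (p / 2 * (α + 2) - 2) (evalFun (α + 2) x) ≤ ENNReal.ofReal (C * ‖x‖) +
      ApNorm p (p / 2 * (α + 2) - 1) (evalFun (α + 2) x) + 2 * ENNReal.ofReal ε := by
  have hb : 0 < α + 2 := by linarith
  have hq := one_lt_half_mul hα hp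
  obtain ⟨y, hyx, hy0, hy⟩ := exists_truncation hb x M
  have hdx := differentiableOn_evalFun hb x
  have hdy := differentiableOn_evalFun hb y
  have hxy : ∀ z ∈ unitDisk, ‖evalFun (α + 2) x z - evalFun (α + 2) y z‖ ≤ ε :=
    fun z hz => (hy z hz).trans hε
  have hyx' : ∀ z ∈ unitDisk, ‖evalFun (α + 2) y z - evalFun (α + 2) x z‖ ≤ ε :=
    fun z hz => norm_sub_rev (evalFun (α + 2) x z) _ ▸ hxy z hz
  have hG : Gfun α p (evalFun (α + 2) y) ^ (1 / p) ≤ ENNReal.ofReal (C * ‖x‖) := by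
    rw [one_div, ENNReal.rpow_inv_le_iff (by linarith),
      ENNReal.ofReal_rpow_of_nonneg (by positivity) (by linarith)]
    refine (Gfun_evalFun_le_of_vanishing hα hC hM hy0).trans ?_
    gcongr
  calc ApNorm p (p / 2 * (α + 2) - 2) (evalFun (α + 2) x)
      ≤ ApNorm p (p / 2 * (α + 2) - 2) (evalFun (α + 2) y) + ENNReal.ofReal ε :=
        ApNorm_le_add hdx hdy (by linarith) (by linarith) hxy
    _ ≤ Gfun α p (evalFun (α + 2) y) ^ (1 / p) +
        ApNorm p (p / 2 * (α + 2) - 1) (evalFun (α + 2) y) + ENNReal.ofReal ε := by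
        gcongr
        rw [ApNorm, ApNorm, ApIntPow_eq_Gfun_add hdy hα hp]
        exact ENNReal.rpow_add_le_add_rpow _ _ (by positivity)
          (by rw [div_le_one (by linarith)]; linarith)
    _ ≤ ENNReal.ofReal (C * ‖x‖) + (ApNorm p (p / 2 * (α + 2) - 1) (evalFun (α + 2) x) +
        ENNReal.ofReal ε) + ENNReal.ofReal ε := by
        gcongr
        exact ApNorm_le_add hdy hdx (by linarith) (by linarith) hyx'
    _ = _ := by ring

lemma ApNorm_evalFun_le_of_mem_span {α p C : ℝ} (hα : -1 ≤ α) (hp : 2 < p) (hC : 0 ≤ C) {M : ℕ}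
    (hM : ∀ f : ℂ → ℂ, DifferentiableOn ℂ f unitDisk → A2norm α f = 1 →
      (∀ j ≤ M, iteratedDeriv j f 0 = 0) → Gfun α p f ≤ ENNReal.ofReal (C ^ p))
    {x : SeqSpace} (hx : x ∈ Submodule.span ℂ (kernelVec (α + 2) '' unitDisk)) :
    ApNorm p (p / 2 * (α + 2) - 2) (evalFun (α + 2) x) ≤ ENNReal.ofReal (C * ‖x‖) := by
  have hb : 0 < α + 2 := by linarith
  have hq := one_lt_half_mul hα hp
  obtain ⟨B, hB0, hB⟩ := exists_norm_evalFun_le hb hx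
  choose y hyx hy using fun n => exists_mobius_isometry hb (radiusSeq_mem n) hx
  set D : ℝ := ∑ j ∈ Finset.range (M + 1), (1 / 2) ^ (-(α + 2)) * B * 2 ^ j with hD
  have hle (n : ℕ) : ApNorm p (p / 2 * (α + 2) - 2) (evalFun (α + 2) x) ≤
      ENNReal.ofReal (C * ‖x‖) + (ENNReal.ofReal (p / 2 * (α + 2) - 1 + 1) *
      (∫⁻ z in unitDisk, ENNReal.ofReal (1 - ‖mobius (radiusSeq n) z‖ ^ 2) *
        ENNReal.ofReal ((1 - ‖z‖ ^ 2) ^ (p / 2 * (α + 2) - 2) * ‖evalFun (α + 2) x z‖ ^ p)) /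
        ENNReal.ofReal Real.pi) ^ (1 / p) +
      2 * ENNReal.ofReal ((1 - radiusSeq n ^ 2) ^ ((α + 2) / 2) * D) := by
    have hr := radiusSeq_mem n
    rw [← ApIntPow_mobius_succ hr (hy n), ApNorm, ← ApIntPow_mobius hr (hy n), ← hyx n]
    refine ApNorm_evalFun_le_of_truncation hα hp hC hM (y n) ?_
    rw [hD, Finset.mul_sum]
    exact Finset.sum_le_sum fun j _ =>
      norm_taylorCoeff_le_of_mobius hb hr (differentiableOn_evalFun hb (y n)) hB (hy n) j
  have h1 := tendsto_lintegral_mobius_weight (p := p) (β := p / 2 * (α + 2) - 2) (by linarith)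
    (by linarith) (differentiableOn_evalFun hb x) hB
  have h2 := ((ENNReal.continuous_rpow_const (y := 1 / p)).tendsto _).comp
    (ENNReal.Tendsto.div_const (ENNReal.Tendsto.const_mul
      (a := ENNReal.ofReal (p / 2 * (α + 2) - 1 + 1)) h1 (Or.inr ENNReal.ofReal_ne_top))
      (b := ENNReal.ofReal Real.pi) (Or.inr (by simpa using Real.pi_pos)))
  have h3 : Tendsto (fun n => (1 - radiusSeq n ^ 2) ^ ((α + 2) / 2) * D) atTop (𝓝 0) := by
    have h := (tendsto_one_sub_radiusSeq_sq.rpow_const (p := (α + 2) / 2)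
      (Or.inr (by positivity))).mul_const D
    rwa [Real.zero_rpow (by positivity), zero_mul] at h
  have h4 := ENNReal.Tendsto.const_mul (a := 2) (ENNReal.tendsto_ofReal h3)
    (Or.inr ENNReal.ofNat_ne_top)
  have h5 := (h2.const_add (ENNReal.ofReal (C * ‖x‖))).add h4
  have hp' : 0 < 1 / p := by positivity
  rw [mul_zero, ENNReal.zero_div, ENNReal.zero_rpow_of_pos hp', ENNReal.ofReal_zero, mul_zero,
    add_zero, add_zero] at h5
  exact ge_of_tendsto' h5 hle

lemma ApNorm_evalFun_le {α p C : ℝ} (hα : -1 ≤ α) (hp : 2 < p) (hC : 0 ≤ C) {M : ℕ}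
    (hM : ∀ f : ℂ → ℂ, DifferentiableOn ℂ f unitDisk → A2norm α f = 1 →
      (∀ j ≤ M, iteratedDeriv j f 0 = 0) → Gfun α p f ≤ ENNReal.ofReal (C ^ p))
    (x : SeqSpace) :
    ApNorm p (p / 2 * (α + 2) - 2) (evalFun (α + 2) x) ≤ ENNReal.ofReal (C * ‖x‖) := by
  have hb : 0 < α + 2 := by linarith
  have hp0 : 0 < p := by linarith
  have hx : x ∈ closure (Submodule.span ℂ (kernelVec (α + 2) '' unitDisk) : Set SeqSpace) := by
    rw [← Submodule.topologicalClosure_coe, closure_span_kernelVec hb]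
    trivial
  obtain ⟨y, hy, hlim⟩ := mem_closure_iff_seq_limit.1 hx
  rw [ApNorm_eq_eLpNorm (differentiableOn_evalFun hb x) hp0]
  refine (Lp.eLpNorm_lim_le_liminf_eLpNorm
    (fun n => aestronglyMeasurable_bergmanMeasure (differentiableOn_evalFun hb (y n)) _) _
    (Eventually.of_forall fun z => tendsto_const_nhds.inner hlim)).trans ?_
  have h1 : Tendsto (fun n => ENNReal.ofReal (C * ‖y n‖)) atTop (𝓝 (ENNReal.ofReal (C * ‖x‖))) :=
    ENNReal.tendsto_ofReal (hlim.norm.const_mul C)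
  rw [← h1.liminf_eq]
  refine liminf_le_liminf (Eventually.of_forall fun n => ?_)
  rw [← ApNorm_eq_eLpNorm (differentiableOn_evalFun hb (y n)) hp0]
  exact ApNorm_evalFun_le_of_mem_span hα hp hC hM (hy n)

lemma ApNorm_le_of_Gfun_le {α p C : ℝ} (hα : -1 ≤ α) (hp : 2 < p) (hC : 0 ≤ C) {M : ℕ}
    (hM : ∀ f : ℂ → ℂ, DifferentiableOn ℂ f unitDisk → A2norm α f = 1 →
      (∀ j ≤ M, iteratedDeriv j f 0 = 0) → Gfun α p f ≤ ENNReal.ofReal (C ^ p))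
    {f : ℂ → ℂ} (hf : DifferentiableOn ℂ f unitDisk) (hfin : A2norm α f < ⊤) :
    ApNorm p (p / 2 * (α + 2) - 2) f ≤ ENNReal.ofReal C * A2norm α f := by
  have hb : 0 < α + 2 := by linarith
  obtain ⟨x, hx⟩ := exists_evalFun_eq hα hf hfin
  have hA2 : A2norm α f = ENNReal.ofReal ‖x‖ := by
    rw [← A2norm_evalFun hα x, A2norm, A2norm, A2normSq, A2normSq]
    congr 3 with n
    rw [taylorCoeff_of_hasSum (fun z hz => hasSum_taylorCoeff hf hz),
      taylorCoeff_of_hasSum (a := taylorCoeff f) (f := evalFun (α + 2) x)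
        (fun z hz => hx z hz ▸ hasSum_taylorCoeff hf hz)]
  have hAp : ApNorm p (p / 2 * (α + 2) - 2) f =
      ApNorm p (p / 2 * (α + 2) - 2) (evalFun (α + 2) x) := by
    rw [ApNorm, ApNorm, ApIntPow, ApIntPow]
    congr 3
    exact setLIntegral_congr_fun isOpen_unitDisk.measurableSet fun z hz => by simp only [hx z hz]
  rw [hAp, hA2, ← ENNReal.ofReal_mul hC]
  exact ApNorm_evalFun_le hα hp hC hM x

lemma Ffun_le_of_ApNorm_le {α p C : ℝ} (hα : -1 ≤ α) (hp : 2 < p) (hC : 0 ≤ C) {f : ℂ → ℂ}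
    (hf : DifferentiableOn ℂ f unitDisk)
    (h : ApNorm p (p / 2 * (α + 2) - 2) f ≤ ENNReal.ofReal C) :
    Ffun α p f ≤ ENNReal.ofReal (C ^ p) := by
  refine (Ffun_le_ApIntPow hf hα hp).trans ?_
  rwa [ApNorm, one_div, ENNReal.rpow_inv_le_iff (by linarith),
    ENNReal.ofReal_rpow_of_nonneg hC (by linarith)] at h

end

/-- For α ≥ -1, p > 2 and C ≥ 1, the three statements (a), (b), (c)
are equivalent. -/
theorem statement1 (α p C : ℝ) (hα : -1 ≤ α) (hp : 2 < p) (hC : 1 ≤ C) :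
    ((∀ f : ℂ → ℂ, DifferentiableOn ℂ f unitDisk → A2norm α f < ⊤ →
        ApNorm p (p / 2 * (α + 2) - 2) f ≤ ENNReal.ofReal C * A2norm α f) ↔
      (∀ f : ℂ → ℂ, DifferentiableOn ℂ f unitDisk → A2norm α f = 1 →
        Ffun α p f ≤ ENNReal.ofReal (C ^ p))) ∧
    ((∀ f : ℂ → ℂ, DifferentiableOn ℂ f unitDisk → A2norm α f = 1 →
        Ffun α p f ≤ ENNReal.ofReal (C ^ p)) ↔
      (∃ M : ℕ, 0 < M ∧ ∀ f : ℂ → ℂ, DifferentiableOn ℂ f unitDisk → A2norm α f = 1 →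
        (∀ j ≤ M, iteratedDeriv j f 0 = 0) → Gfun α p f ≤ ENNReal.ofReal (C ^ p))) := by
  have hC0 : 0 ≤ C := by linarith
  have hab (h : ∀ f : ℂ → ℂ, DifferentiableOn ℂ f unitDisk → A2norm α f < ⊤ →
      ApNorm p (p / 2 * (α + 2) - 2) f ≤ ENNReal.ofReal C * A2norm α f) (f : ℂ → ℂ)
      (hf : DifferentiableOn ℂ f unitDisk) (hf1 : A2norm α f = 1) :
      Ffun α p f ≤ ENNReal.ofReal (C ^ p) := by
    refine Ffun_le_of_ApNorm_le hα hp hC0 hf ?_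
    simpa [hf1] using h f hf (by simp [hf1])
  refine ⟨⟨hab, fun h f hf hfin => ?_⟩, fun h => ?_, ?_⟩
  · exact ApNorm_le_of_Gfun_le (M := 1) hα hp hC0
      (fun g hg hg1 _ => (Gfun_le_Ffun hα hp).trans (h g hg hg1)) hf hfin
  · exact ⟨1, one_pos, fun g hg hg1 _ => (Gfun_le_Ffun hα hp).trans (h g hg hg1)⟩
  · rintro ⟨M, -, hM⟩
    exact hab fun f hf hfin => ApNorm_le_of_Gfun_le hα hp hC0 hM hf hfin

end
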